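/- arXiv:2005.02542 — 2 statements merged into one kernel-verified Lean document; each statement's English description precedes it below -/
import Mathlib

section
/- Let n ≥ 2, let Ω ⊂ ℝⁿ be a bounded open convex set with B₁ ⊆ Ω ⊆ B_n (balls centered at the origin), and let v ∈ C²(Ω) ∩ C⁰(Ω̄) be a convex function with (det D²v)^{1/n} = f in Ω, v = 0 on ∂Ω, and 1 ≤ f ≤ f_max in Ω for a constant f_max. Then for every ρ with 0 < ρ < diam(Ω)/2 there exist a constant H > 0 depending only on n, f_max, ρ and a constant θ ∈ (0,1) depending only on n, f_max such that for every integer j ≥ 0 and every x ∈ Ω_ρ: S(v, 2^{−j} H, x) ⊆ B_{θ^j ρ}(x) ⊆ Ω. -/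
open scoped RealInnerProductSpace
noncomputable section

abbrev Euc (n : ℕ) := EuclideanSpace ℝ (Fin n)

/-- Hessian matrix of `u` at `x`. -/
def hessianMatrix {n : ℕ} (u : Euc n → ℝ) (x : Euc n) : Matrix (Fin n) (Fin n) ℝ :=
  Matrix.of fun i j =>
    iteratedFDeriv ℝ 2 u x ![EuclideanSpace.single i 1, EuclideanSpace.single j 1]

/-- Determinant of the Hessian of `u` at `x`. -/
def hessDet {n : ℕ} (u : Euc n → ℝ) (x : Euc n) : ℝ := (hessianMatrix u x).det

/-- Section of `v` at height `h` about `x`, within the domain `Ω`. -/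
def secAt {n : ℕ} (v : Euc n → ℝ) (h : ℝ) (x : Euc n) (Ω : Set (Euc n)) : Set (Euc n) :=
  {z ∈ Ω | v z < v x + ⟪gradient v x, z - x⟫ + h}


/-! ### Matrix lemmas -/

lemma one_le_det_one_add {n : ℕ} {P : Matrix (Fin n) (Fin n) ℝ} (hP : P.PosSemidef) :
    1 ≤ (1 + P).det := by
  have hH : (1 + P).IsHermitian := Matrix.isHermitian_one.add hP.isHermitian
  rw [hH.det_eq_prod_eigenvalues]
  have key : ∀ i, 1 ≤ hH.eigenvalues i := by
    intro i
    have h1 := hH.eigenvalues_eq i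
    set x := (hH.eigenvectorBasis i) with hx
    have h2 : ‖x‖ = 1 := hH.eigenvectorBasis.orthonormal.1 i
    have h3 := hP.dotProduct_mulVec_nonneg x.ofLp
    have h4 : x.ofLp ⬝ᵥ x.ofLp = 1 := by
      have := EuclideanSpace.real_norm_sq_eq x
      rw [h2] at this
      simp only [dotProduct]
      rw [← one_pow 2, this]
      exact Finset.sum_congr rfl fun i _ => (sq _).symm
    rw [h1]
    simp only [star_trivial, Matrix.add_mulVec, Matrix.one_mulVec, dotProduct_add, h4,
      RCLike.re_to_real] at h3 ⊢
    linarith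
  have : (∏ i : Fin n, (1 : ℝ)) ≤ ∏ i, hH.eigenvalues i :=
    Finset.prod_le_prod (fun _ _ => zero_le_one) (fun i _ => key i)
  simpa using this

lemma det_mono {n : ℕ} {A B : Matrix (Fin n) (Fin n) ℝ} (hA : A.PosSemidef) (hd : 0 < A.det)
    (hAB : (B - A).PosSemidef) : A.det ≤ B.det := by
  obtain ⟨S, hS⟩ : ∃ S : Matrix (Fin n) (Fin n) ℝ, A = S.conjTranspose * S := by
    open scoped MatrixOrder Matrix.Norms.L2Operator in
    exact CStarAlgebra.nonneg_iff_eq_star_mul_self.mp hA.nonneg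
  have hS' : A.det = S.det * S.det := by
    rw [hS, Matrix.det_mul, Matrix.conjTranspose_eq_transpose_of_trivial, Matrix.det_transpose]
  have hSu : IsUnit S.det := by
    rw [isUnit_iff_ne_zero]; rintro h; rw [hS', h] at hd; simp at hd
  have hP : (S⁻¹.conjTranspose * (B - A) * S⁻¹).PosSemidef := hAB.conjTranspose_mul_mul_same _
  have h1 := one_le_det_one_add hP
  have h2 : B = S.conjTranspose * (1 + S⁻¹.conjTranspose * (B - A) * S⁻¹) * S := by
    have e1 : S⁻¹ * S = 1 := Matrix.nonsing_inv_mul _ hSu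
    have e2 : S.conjTranspose * S⁻¹.conjTranspose = 1 := by
      rw [← Matrix.conjTranspose_mul, e1, Matrix.conjTranspose_one]
    calc B = A + 1 * (B - A) * 1 := by simp
      _ = S.conjTranspose * S + (S.conjTranspose * S⁻¹.conjTranspose) * (B - A) * (S⁻¹ * S) := by
        rw [e1, e2, ← hS]
      _ = _ := by simp only [Matrix.mul_add, Matrix.add_mul, Matrix.mul_one, Matrix.mul_assoc]
  have h3 : B.det = A.det * (1 + S⁻¹.conjTranspose * (B - A) * S⁻¹).det := by
    conv_lhs => rw [h2]
    rw [Matrix.det_mul, Matrix.det_mul, Matrix.conjTranspose_eq_transpose_of_trivial S,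
      Matrix.det_transpose, hS']
    ring
  rw [h3]
  nlinarith

/-! ### Quadratic comparison functions -/

/-- `q` is a quadratic polynomial whose second derivative in direction `d` is `Q d`. -/
def IsQuad {n : ℕ} (q : Euc n → ℝ) (Q : Euc n → ℝ) : Prop :=
  ∀ z d, ∃ b : ℝ, ∀ t : ℝ, q (z + t • d) = q z + t * b + t ^ 2 / 2 * Q d

lemma IsQuad.add {n : ℕ} {q q' Q Q' : Euc n → ℝ} (h : IsQuad q Q) (h' : IsQuad q' Q') :
    IsQuad (fun z => q z + q' z) (fun z => Q z + Q' z) := by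
  intro z d
  obtain ⟨b, hb⟩ := h z d
  obtain ⟨b', hb'⟩ := h' z d
  exact ⟨b + b', fun t => by simp only [hb, hb']; ring⟩

lemma IsQuad.const_mul {n : ℕ} {q Q : Euc n → ℝ} (h : IsQuad q Q) (c : ℝ) :
    IsQuad (fun z => c * q z) (fun z => c * Q z) := by
  intro z d
  obtain ⟨b, hb⟩ := h z d
  exact ⟨c * b, fun t => by simp only [hb]; ring⟩

lemma IsQuad.affine {n : ℕ} (c : ℝ) (f : Euc n →L[ℝ] ℝ) :
    IsQuad (fun z => c + f z) (fun _ => 0) := by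
  intro z d
  exact ⟨f d, fun t => by simp [map_add]; ring⟩

lemma IsQuad.sq {n : ℕ} (c : ℝ) (f : Euc n →L[ℝ] ℝ) :
    IsQuad (fun z => (c + f z) ^ 2) (fun d => 2 * (f d) ^ 2) := by
  intro z d
  exact ⟨2 * (c + f z) * f d, fun t => by simp [map_add]; ring⟩

lemma IsQuad.sum {n : ℕ} {ι : Type*} (s : Finset ι) {q Q : ι → Euc n → ℝ}
    (h : ∀ i, IsQuad (q i) (Q i)) :
    IsQuad (fun z => ∑ i ∈ s, q i z) (fun z => ∑ i ∈ s, Q i z) := by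
  intro z d
  choose b hb using fun i => h i z d
  refine ⟨∑ i ∈ s, b i, fun t => ?_⟩
  simp only [hb, Finset.sum_add_distrib, Finset.mul_sum]

lemma second_deriv_nonneg_of_isLocalMin {g g' : ℝ → ℝ} {c : ℝ}
    (h1 : ∀ᶠ t in nhds 0, HasDerivAt g (g' t) t) (h2 : HasDerivAt g' c 0)
    (hm : IsLocalMin g 0) : 0 ≤ c := by
  by_contra hc
  push Not at hc
  have hd : deriv g =ᶠ[nhds 0] g' := h1.mono fun t ht => ht.deriv
  have hdd : deriv (deriv g) 0 = c := by rw [hd.deriv_eq]; exact h2.deriv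
  have h0 : deriv g 0 = 0 := hm.deriv_eq_zero
  have hmax : IsLocalMax g 0 := isLocalMax_of_deriv_deriv_neg (by rw [hdd]; exact hc) h0
    h1.self_of_nhds.continuousAt
  have hcst : g =ᶠ[nhds 0] fun _ => g 0 := by
    filter_upwards [hm, hmax] with t a b using le_antisymm b a
  have h3 : deriv g =ᶠ[nhds 0] fun _ => 0 := by
    have := hcst.deriv
    simpa using this
  have h4 : deriv (deriv g) 0 = 0 := by rw [h3.deriv_eq]; simp
  rw [hdd] at h4
  linarith

lemma second_order_min {n : ℕ} {v q Q : Euc n → ℝ} {z : Euc n} (hv : ContDiffAt ℝ 2 v z)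
    (hq : IsQuad q Q) (hm : IsLocalMin (fun y => v y - q y) z) (d : Euc n) :
    Q d ≤ iteratedFDeriv ℝ 2 v z ![d, d] := by
  obtain ⟨b, hb⟩ := hq z d
  have hline : ∀ t : ℝ, HasDerivAt (fun t : ℝ => z + t • d) d t := by
    intro t
    simpa using ((hasDerivAt_id t).smul_const d).const_add z
  have hcont : Filter.Tendsto (fun t : ℝ => z + t • d) (nhds 0) (nhds z) := by
    have := (hline 0).continuousAt.tendsto
    simpa using this
  have hdiff : ∀ᶠ y in nhds z, DifferentiableAt ℝ v y := by
    have := hv.eventually (by simp)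
    filter_upwards [this] with y hy using hy.differentiableAt (by simp)
  have hfd : DifferentiableAt ℝ (fderiv ℝ v) z :=
    (hv.fderiv_right (m := 1) (by norm_num)).differentiableAt (by simp)
  rw [iteratedFDeriv_two_apply]
  simp only [Matrix.cons_val_zero, Matrix.cons_val_one]
  have h := second_deriv_nonneg_of_isLocalMin
    (g := fun t : ℝ => v (z + t • d) - q (z + t • d))
    (g' := fun t : ℝ => fderiv ℝ v (z + t • d) d - (b + t * Q d))
    (c := fderiv ℝ (fderiv ℝ v) z d d - Q d) ?_ ?_ ?_
  · linarith
  · filter_upwards [hcont.eventually hdiff] with t ht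
    have e1 := ht.hasFDerivAt.comp_hasDerivAt t (hline t)
    have e2 : HasDerivAt (fun t : ℝ => q (z + t • d)) (b + t * Q d) t := by
      simp only [hb]
      have := (((hasDerivAt_id t).mul_const b).const_add (q z)).add
        ((((hasDerivAt_id t).pow 2).div_const 2).mul_const (Q d))
      exact this.congr_deriv (by simp)
    exact e1.sub e2
  · have hz : z = z + (0:ℝ) • d := by simp
    have e0 : HasFDerivAt (fderiv ℝ v) (fderiv ℝ (fderiv ℝ v) z) (z + (0:ℝ) • d) := by
      rw [← hz]; exact hfd.hasFDerivAt
    have e1 := (e0.comp_hasDerivAt (0:ℝ) (hline 0))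
    have e2 := e1.clm_apply (hasDerivAt_const (0:ℝ) d)
    have e3 := ((hasDerivAt_id (0:ℝ)).mul_const (Q d)).const_add b
    have e4 := e2.sub e3
    exact e4.congr_deriv (by simp)
  · have : IsLocalMin (fun y => v y - q y) (z + (0:ℝ) • d) := by simpa using hm
    have hm' : ∀ᶠ y in nhds z, v z - q z ≤ v y - q y := hm
    have := hcont.eventually hm'
    simpa [IsLocalMin, IsMinFilter] using this

lemma hess_form {n : ℕ} (v : Euc n → ℝ) (z d : Euc n) :
    iteratedFDeriv ℝ 2 v z ![d, d] = d.ofLp ⬝ᵥ (hessianMatrix v z).mulVec d.ofLp := by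
  have hd : d = ∑ i, d.ofLp i • (EuclideanSpace.single i (1:ℝ) : Euc n) := by
    ext j
    simp [Finset.sum_apply, Pi.single_apply]
  simp only [hessianMatrix, iteratedFDeriv_two_apply, Matrix.cons_val_zero, Matrix.cons_val_one,
    dotProduct, Matrix.mulVec, Matrix.of_apply]
  conv_lhs => rw [hd]
  simp only [map_sum, map_smul, _root_.sum_apply, _root_.smul_apply,
    smul_eq_mul, Finset.mul_sum]
  rw [Finset.sum_comm]
  refine Finset.sum_congr rfl fun i _ => Finset.sum_congr rfl fun j _ => ?_
  ring

lemma hess_symm {n : ℕ} {v : Euc n → ℝ} {z : Euc n} (hv : ContDiffAt ℝ 2 v z) :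
    (hessianMatrix v z).IsHermitian := by
  have h := hv.isSymmSndFDerivAt (by simp)
  ext i j
  simp only [hessianMatrix, iteratedFDeriv_two_apply, Matrix.cons_val_zero, Matrix.cons_val_one,
    Matrix.conjTranspose_apply, Matrix.of_apply, star_trivial]
  exact h _ _

lemma posSemidef_of_form {n : ℕ} {A : Matrix (Fin n) (Fin n) ℝ} (hA : A.IsHermitian)
    (h : ∀ d : Euc n, 0 ≤ d.ofLp ⬝ᵥ A.mulVec d.ofLp) : A.PosSemidef := by
  refine Matrix.PosSemidef.of_dotProduct_mulVec_nonneg hA fun x => ?_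
  simpa using h (WithLp.toLp 2 x)

/-- Comparison at an interior minimum. -/
lemma det_le_of_min {n : ℕ} {v q Q : Euc n → ℝ} {z : Euc n} (hv : ContDiffAt ℝ 2 v z)
    (hq : IsQuad q Q) (hm : IsLocalMin (fun y => v y - q y) z)
    {A : Matrix (Fin n) (Fin n) ℝ} (hA : A.PosSemidef) (hd : 0 < A.det)
    (hQ : ∀ d : Euc n, Q d = d.ofLp ⬝ᵥ A.mulVec d.ofLp) : A.det ≤ hessDet v z := by
  refine det_mono hA hd (posSemidef_of_form ((hess_symm hv).sub hA.isHermitian) fun d => ?_)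
  have := second_order_min hv hq hm d
  rw [hess_form, hQ] at this
  rw [Matrix.sub_mulVec, dotProduct_sub]
  linarith

lemma grad_ineq {n : ℕ} {Ω : Set (Euc n)} {v : Euc n → ℝ} {x z : Euc n}
    (hc : ConvexOn ℝ Ω v) (hx : x ∈ Ω) (hz : z ∈ Ω) (hd : DifferentiableAt ℝ v x) :
    v x + fderiv ℝ v x (z - x) ≤ v z := by
  have hline : HasDerivAt (fun t : ℝ => x + t • (z - x)) (z - x) 0 := by
    simpa using ((hasDerivAt_id (0:ℝ)).smul_const (z - x)).const_add x
  have h0 : x = x + (0:ℝ) • (z - x) := by simp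
  have e0 : HasFDerivAt v (fderiv ℝ v x) (x + (0:ℝ) • (z - x)) := by
    rw [← h0]; exact hd.hasFDerivAt
  have e1 := e0.comp_hasDerivAt (0:ℝ) hline
  have hconv : ConvexOn ℝ (Set.Icc (0:ℝ) 1) (v ∘ fun t : ℝ => x + t • (z - x)) := by
    refine ⟨convex_Icc _ _, ?_⟩
    intro s hs t ht a b ha hb hab
    have hp : ∀ r ∈ Set.Icc (0:ℝ) 1, x + r • (z - x) ∈ Ω := fun r hr =>
      hc.1.add_smul_sub_mem hx hz hr
    have := hc.2 (hp s hs) (hp t ht) ha hb hab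
    have e : a • (x + s • (z - x)) + b • (x + t • (z - x))
        = x + (a • s + b • t) • (z - x) := by
      have : a = 1 - b := by linarith
      subst this
      simp only [smul_eq_mul]
      module
    rw [e] at this
    exact this
  have := hconv.le_slope_of_hasDerivAt (x := 0) (y := 1) (by simp) (by simp) one_pos e1
  simp only [slope, Function.comp, vsub_eq_sub] at this
  simp at this
  rw [map_sub]
  linarith

lemma hess_posSemidef {n : ℕ} {Ω : Set (Euc n)} {v : Euc n → ℝ} {z : Euc n}
    (ho : IsOpen Ω) (hc : ConvexOn ℝ Ω v) (hz : z ∈ Ω) (hv : ContDiffAt ℝ 2 v z) :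
    (hessianMatrix v z).PosSemidef := by
  refine posSemidef_of_form (hess_symm hv) fun d => ?_
  rw [← hess_form]
  refine second_order_min hv (IsQuad.affine (v z - fderiv ℝ v z z) (fderiv ℝ v z)) ?_ d
  filter_upwards [ho.mem_nhds hz] with y hy
  have := grad_ineq hc hz hy (hv.differentiableAt (by simp))
  rw [map_sub] at this
  linarith

/-- Comparison at an interior maximum. -/
lemma det_ge_of_max {n : ℕ} {Ω : Set (Euc n)} {v q Q : Euc n → ℝ} {z : Euc n}
    (ho : IsOpen Ω) (hc : ConvexOn ℝ Ω v) (hz : z ∈ Ω) (hv : ContDiffAt ℝ 2 v z)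
    (hpos : 0 < hessDet v z)
    (hq : IsQuad q Q) (hm : IsLocalMax (fun y => v y - q y) z)
    {A : Matrix (Fin n) (Fin n) ℝ} (hA : A.IsHermitian)
    (hQ : ∀ d : Euc n, Q d = d.ofLp ⬝ᵥ A.mulVec d.ofLp) : hessDet v z ≤ A.det := by
  refine det_mono (hess_posSemidef ho hc hz hv) hpos
    (posSemidef_of_form (hA.sub (hess_symm hv)) fun d => ?_)
  have h1 : IsLocalMin (fun y => (-v) y - (-1) * q y) z := by
    filter_upwards [hm] with y hy
    simp only [Pi.neg_apply]
    linarith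
  have := second_order_min (v := -v) hv.neg (hq.const_mul (-1)) h1 d
  rw [iteratedFDeriv_neg_apply] at this
  simp only [_root_.neg_apply] at this
  rw [hess_form, hQ] at this
  rw [Matrix.sub_mulVec, dotProduct_sub]
  linarith

/-! ### Normalisation by a simplex of maximal volume -/

/-- The coordinate functionals given by the rows of a matrix. -/
def rowFun {n : ℕ} (L : Matrix (Fin n) (Fin n) ℝ) (i : Fin n) : Euc n →L[ℝ] ℝ :=
  LinearMap.toContinuousLinearMap
    ((LinearMap.proj i).comp (L.mulVecLin.comp (WithLp.linearEquiv 2 ℝ (Fin n → ℝ)).toLinearMap))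

lemma rowFun_apply {n : ℕ} (L : Matrix (Fin n) (Fin n) ℝ) (i : Fin n) (d : Euc n) :
    rowFun L i d = L.mulVec d.ofLp i := by
  simp [rowFun]

lemma simplex_normalisation {n : ℕ} {K : Set (Euc n)} (hK : IsCompact K) {p₀ : Euc n}
    (hp : p₀ ∈ interior K) :
    ∃ (L : Matrix (Fin n) (Fin n) ℝ) (P : Fin n → Euc n), L.det ≠ 0 ∧ (∀ i, P i ∈ K) ∧
      (∀ z ∈ K, ∀ i, |rowFun L i (z - p₀)| ≤ 1) ∧
      ∀ d, d = ∑ i, rowFun L i d • (P i - p₀) := by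
  let F : (Fin n → Euc n) → Matrix (Fin n) (Fin n) ℝ := fun p => Matrix.of fun i j => (p j - p₀) i
  have hFc : Continuous fun p => |(F p).det| := by
    refine continuous_abs.comp (Continuous.matrix_det ?_)
    refine continuous_matrix fun i j => ?_
    simp only [F, Matrix.of_apply, PiLp.sub_apply]
    fun_prop
  have hcpt : IsCompact (Set.univ.pi fun _ : Fin n => K) := isCompact_univ_pi fun _ => hK
  have hp0 : p₀ ∈ K := interior_subset hp
  obtain ⟨P, hPK, hPmax⟩ := hcpt.exists_isMaxOn ⟨fun _ => p₀, fun _ _ => hp0⟩ hFc.continuousOn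
  have hPK' : ∀ i, P i ∈ K := fun i => hPK i (Set.mem_univ _)
  have hdet : (F P).det ≠ 0 := by
    obtain ⟨η, hη, hb⟩ := Metric.mem_nhds_iff.1 (mem_interior_iff_mem_nhds.1 hp)
    let R : Fin n → Euc n := fun j => p₀ + EuclideanSpace.single j (η / 2)
    have hR : R ∈ Set.univ.pi fun _ : Fin n => K := by
      intro j _
      apply hb
      simp only [R, Metric.mem_ball, dist_self_add_left, PiLp.norm_single,
        Real.norm_eq_abs]
      rw [abs_of_pos (by positivity)]
      linarith
    have h1 : F R = (η / 2) • (1 : Matrix (Fin n) (Fin n) ℝ) := by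
      ext i j
      simp [F, R, Matrix.one_apply]
    have h2 := hPmax hR
    simp only [Set.mem_ofPred_eq, h1, Matrix.det_smul, Matrix.det_one, mul_one] at h2
    intro h0
    rw [h0, abs_zero] at h2
    have : 0 < |(η / 2) ^ Fintype.card (Fin n)| := by positivity
    linarith
  have hu : IsUnit (F P).det := isUnit_iff_ne_zero.2 hdet
  have hcr : ∀ (d : Euc n) (i : Fin n), rowFun (F P)⁻¹ i d =
      ((F P).det)⁻¹ * ((F P).updateCol i d.ofLp).det := by
    intro d i
    have e1 : (F P)⁻¹.mulVec d.ofLp = ((F P).det)⁻¹ • (F P).cramer d.ofLp := by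
      have := Matrix.mulVec_cramer (F P) d.ofLp
      have h2 : d.ofLp = (F P).mulVec (((F P).det)⁻¹ • (F P).cramer d.ofLp) := by
        rw [Matrix.mulVec_smul, this, smul_smul, inv_mul_cancel₀ hdet, one_smul]
      conv_lhs => rw [h2]
      rw [Matrix.mulVec_mulVec, Matrix.nonsing_inv_mul _ hu, Matrix.one_mulVec]
    rw [rowFun_apply, e1, Pi.smul_apply, Matrix.cramer_apply, smul_eq_mul]
  refine ⟨(F P)⁻¹, P, ?_, hPK', ?_, ?_⟩
  · rw [Matrix.det_nonsing_inv]
    simpa using hdet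
  · intro z hz i
    rw [hcr, abs_mul, abs_inv]
    have h1 : (F P).updateCol i (z - p₀).ofLp = F (Function.update P i z) := by
      ext a b
      by_cases hb : b = i
      · subst hb; simp [F]
      · simp [F, hb]
    have h2 : Function.update P i z ∈ Set.univ.pi fun _ : Fin n => K := by
      intro j _
      by_cases hj : j = i
      · subst hj; simpa using hz
      · simpa [hj] using hPK' j
    have h3 : |(F (Function.update P i z)).det| ≤ |(F P).det| := hPmax h2
    rw [h1, inv_mul_le_iff₀ (abs_pos.2 hdet)]
    linarith
  · intro d
    have h1 : d.ofLp = (F P).mulVec ((F P)⁻¹.mulVec d.ofLp) := by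
      rw [Matrix.mulVec_mulVec, Matrix.mul_nonsing_inv _ hu, Matrix.one_mulVec]
    ext j
    have h2 := congrFun h1 j
    rw [h2]
    simp only [rowFun_apply, Matrix.mulVec, dotProduct, F, Matrix.of_apply]
    simp [Finset.sum_apply, mul_comm]

lemma simplex_mem {n : ℕ} {K : Set (Euc n)} (hc : Convex ℝ K) {p₀ : Euc n} (hp : p₀ ∈ K)
    {P : Fin n → Euc n} (hP : ∀ i, P i ∈ K) {t : Fin n → ℝ} (ht : ∀ i, 0 ≤ t i)
    (hs : ∑ i, t i ≤ 1) : p₀ + ∑ i, t i • (P i - p₀) ∈ K := by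
  have := hc.sum_mem (t := Finset.univ) (w := fun o : Option (Fin n) => o.elim (1 - ∑ i, t i) t)
    (z := fun o : Option (Fin n) => o.elim p₀ P) ?_ ?_ ?_
  · rw [Fintype.sum_option] at this
    simp only [Option.elim] at this
    convert this using 1
    simp only [smul_sub, Finset.sum_sub_distrib, ← Finset.sum_smul]
    module
  · rintro (_ | i) _
    · simpa using hs
    · simpa using ht i
  · rw [Fintype.sum_option]; simp
  · rintro (_ | i) _
    · simpa using hp
    · simpa using hP i

/-- The Hessian of the comparison functions. -/
def cmpMat {n : ℕ} (L : Matrix (Fin n) (Fin n) ℝ) (a : Fin n → ℝ) (τ B : ℝ) :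
    Matrix (Fin n) (Fin n) ℝ :=
  L.transpose * (τ • (1 : Matrix (Fin n) (Fin n) ℝ) + B • Matrix.vecMulVec a a) * L

lemma cmpMat_posSemidef {n : ℕ} (L : Matrix (Fin n) (Fin n) ℝ) (a : Fin n → ℝ) {τ B : ℝ}
    (hτ : 0 ≤ τ) (hB : 0 ≤ B) : (cmpMat L a τ B).PosSemidef := by
  have h := Matrix.posSemidef_vecMulVec_self_star a
  rw [star_trivial] at h
  have := ((Matrix.PosSemidef.one.smul hτ).add (h.smul hB)).conjTranspose_mul_mul_same L
  rwa [Matrix.conjTranspose_eq_transpose_of_trivial] at this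

lemma cmpMat_det {n : ℕ} (L : Matrix (Fin n) (Fin n) ℝ) (a : Fin n → ℝ) {τ B : ℝ}
    (hτ : τ ≠ 0) : (cmpMat L a τ B).det = L.det ^ 2 * (τ ^ n * (1 + B / τ * ∑ i, a i ^ 2)) := by
  have h1 : τ • (1 : Matrix (Fin n) (Fin n) ℝ) + B • Matrix.vecMulVec a a =
      τ • (1 + Matrix.replicateCol Unit ((B / τ) • a) * Matrix.replicateRow Unit a) := by
    rw [smul_add]
    congr 1
    ext i j
    simp [Matrix.vecMulVec_apply, Matrix.mul_apply]
    field_simp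
  rw [cmpMat, Matrix.det_mul, Matrix.det_mul, Matrix.det_transpose, h1, Matrix.det_smul,
    Matrix.det_one_add_replicateCol_mul_replicateRow]
  simp only [Fintype.card_fin, dotProduct, Pi.smul_apply, smul_eq_mul, Finset.mul_sum]
  have : ∑ x, a x * (B / τ * a x) = ∑ i, B / τ * a i ^ 2 :=
    Finset.sum_congr rfl fun i _ => by ring
  rw [this]
  ring

lemma cmpMat_form {n : ℕ} (L : Matrix (Fin n) (Fin n) ℝ) (a : Fin n → ℝ) (τ B : ℝ) (d : Euc n) :
    d.ofLp ⬝ᵥ (cmpMat L a τ B).mulVec d.ofLp =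
      τ * ∑ i, (rowFun L i d) ^ 2 + B * (∑ i, a i * rowFun L i d) ^ 2 := by
  simp only [rowFun_apply]
  rw [cmpMat, ← Matrix.mulVec_mulVec, ← Matrix.mulVec_mulVec, Matrix.dotProduct_mulVec,
    Matrix.vecMul_transpose]
  set y := L.mulVec d.ofLp
  rw [Matrix.add_mulVec, Matrix.smul_mulVec, Matrix.smul_mulVec, Matrix.one_mulVec,
    Matrix.vecMulVec_mulVec, dotProduct_add, dotProduct_smul, dotProduct_smul]
  have e1 : y ⬝ᵥ y = ∑ i, y i ^ 2 := Finset.sum_congr rfl fun i _ => (sq _).symm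
  have e2 : a ⬝ᵥ y = ∑ i, a i * y i := rfl
  rw [e1]
  simp only [op_smul_eq_smul, dotProduct_smul, smul_eq_mul]
  rw [dotProduct_comm y a, e2]
  ring

/-! ### The Monge-Ampere setting -/

/-- `v` is a convex `C²` function with `1 ≤ det D²v ≤ Λ` on the bounded convex domain `Ω`. -/
structure MongeAmpere {n : ℕ} (Λ : ℝ) (Ω : Set (Euc n)) (v : Euc n → ℝ) : Prop where
  isOpen : IsOpen Ω
  bdd : Bornology.IsBounded Ω
  c2 : ContDiffOn ℝ 2 v Ω
  cont : ContinuousOn v (closure Ω)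
  conv : ConvexOn ℝ Ω v
  one_le : ∀ z ∈ Ω, 1 ≤ hessDet v z
  le : ∀ z ∈ Ω, hessDet v z ≤ Λ

lemma MongeAmpere.c2At {n : ℕ} {Λ : ℝ} {Ω : Set (Euc n)} {v : Euc n → ℝ}
    (h : MongeAmpere Λ Ω v) {z : Euc n} (hz : z ∈ Ω) : ContDiffAt ℝ 2 v z :=
  h.c2.contDiffAt (h.isOpen.mem_nhds hz)

lemma MongeAmpere.mem_of_closure {n : ℕ} {Λ : ℝ} {Ω : Set (Euc n)} {v : Euc n → ℝ}
    (_h : MongeAmpere Λ Ω v) {z : Euc n} (hz : z ∈ closure Ω) (hz' : z ∉ frontier Ω) : z ∈ Ω := by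
  rw [frontier, Set.mem_sdiff, not_and, not_not] at hz'
  exact interior_subset (hz' hz)

set_option maxHeartbeats 4000000 in
/-- Aleksandrov-type estimate in an affine invariant form: a point where `v` is well below the
affine function `c + f` is not too close to any supporting hyperplane of the section. -/
lemma section_core (n : ℕ) (hn : 1 ≤ n) (Λ : ℝ) : ∃ δ : ℝ, 0 < δ ∧ δ < 1 ∧
    ∀ (Ω : Set (Euc n)) (v : Euc n → ℝ), MongeAmpere Λ Ω v →
    ∀ (c : ℝ) (f : Euc n →L[ℝ] ℝ), (∀ z ∈ frontier Ω, c + f z ≤ v z) →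
    ∀ m : ℝ, 0 < m → (∀ z ∈ Ω, c + f z - m ≤ v z) →
    ∀ x₀ ∈ Ω, v x₀ ≤ c + f x₀ - m / 4 →
    ∀ (g : Euc n →L[ℝ] ℝ) (M : ℝ), (∀ z ∈ Ω, v z < c + f z → g z ≤ M) →
    ∀ p ∈ Ω, v p < c + f p → δ * (M - g p) ≤ M - g x₀ := by
  have hN : (1:ℝ) ≤ n := by exact_mod_cast hn
  set N : ℝ := (n : ℝ) with hNdef
  set B₀ : ℝ := |Λ| * (64 * N ^ 3) ^ n with hB₀
  have hB₀nn : 0 ≤ B₀ := by positivity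
  refine ⟨1 / (8 * (B₀ + 1)), by positivity, ?_, ?_⟩
  · rw [div_lt_one (by positivity)]; linarith
  set δ : ℝ := 1 / (8 * (B₀ + 1)) with hδ
  have hδpos : 0 < δ := by positivity
  have hδB : B₀ * δ ≤ 1 / 8 := by
    rw [hδ, mul_one_div, div_le_div_iff₀ (by positivity) (by norm_num)]; linarith
  have hδ4 : δ ≤ 1 / 4 := by
    rw [hδ, div_le_div_iff₀ (by positivity) (by norm_num)]; linarith
  intro Ω v hMA c f hbd m hm hlow x₀ hx₀ hvx₀ g M hM p hp hvp
  by_contra hcon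
  push Not at hcon
  -- the section
  set G : Set (Euc n) := {z ∈ Ω | v z < c + f z} with hG
  have hfc : Continuous fun z => c + f z := by fun_prop
  have hGsub : G ⊆ Ω := fun z hz => hz.1
  have hGo : IsOpen G := by
    have := (hMA.c2.continuousOn.sub hfc.continuousOn).isOpen_inter_preimage hMA.isOpen
      (isOpen_Iio (a := (0:ℝ)))
    have e : G = Ω ∩ (v - fun z => c + f z) ⁻¹' Set.Iio 0 := by
      refine Set.ext fun z => ⟨fun h => ⟨h.1, ?_⟩, fun h => ⟨h.1, ?_⟩⟩
      · exact sub_neg.2 h.2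
      · exact sub_neg.1 h.2
    rw [e]
    exact this
  have hGconv : Convex ℝ G := by
    have h2 : ConvexOn ℝ Ω fun z => v z - (c + f z) := by
      refine hMA.conv.sub ⟨hMA.conv.1, ?_⟩
      intro x _ y _ a b ha hb hab
      simp only [map_add, map_smul, smul_eq_mul]
      have : a = 1 - b := by linarith
      subst this
      linarith
    have := h2.convex_lt 0
    have e : G = {x ∈ Ω | v x - (c + f x) < 0} := by
      refine Set.ext fun z => ⟨fun h => ⟨h.1, ?_⟩, fun h => ⟨h.1, ?_⟩⟩
      · exact sub_neg.2 h.2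
      · exact sub_neg.1 h.2
    rw [e]
    exact this
  have hx₀G : x₀ ∈ G := ⟨hx₀, by linarith⟩
  have hpG : p ∈ G := ⟨hp, hvp⟩
  set K := closure G with hK
  have hKΩ : K ⊆ closure Ω := closure_mono hGsub
  have hKc : IsCompact K := (hMA.bdd.subset hGsub).isCompact_closure
  have hvK : ContinuousOn v K := hMA.cont.mono hKΩ
  have hKconv : Convex ℝ K := hGconv.closure
  have hGK : G ⊆ K := subset_closure
  have hle : ∀ z ∈ K, v z ≤ c + f z := by
    intro z hz
    have h2 : z ∈ closure G := hz
    have h3 := ContinuousWithinAt.closure_le (f := v) (g := fun z => c + f z) h2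
      ((hvK z hz).mono hGK) hfc.continuousWithinAt (fun y hy => hy.2.le)
    exact h3
  have hKG : ∀ z ∈ K, v z < c + f z → z ∈ G := by
    intro z hz hlt
    refine ⟨hMA.mem_of_closure (hKΩ hz) fun hfr => ?_, hlt⟩
    have := hbd z hfr
    linarith
  have hKitr : interior K = G := by
    rw [hK, hGconv.interior_closure_eq_interior_of_nonempty_interior
      (by rw [hGo.interior_eq]; exact ⟨_, hx₀G⟩), hGo.interior_eq]
  have hgK : ∀ z ∈ K, g z ≤ M := by
    intro z hz
    exact ContinuousWithinAt.closure_le (f := g) (g := fun _ => M) (s := G) hz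
      g.continuous.continuousWithinAt continuousWithinAt_const (fun y hy => hM y hy.1 hy.2)
  -- the farthest point
  obtain ⟨p', hp'K, hp'⟩ := hKc.exists_isMinOn ⟨x₀, hGK hx₀G⟩ g.continuous.continuousOn
  have hp'min : ∀ z ∈ K, g p' ≤ g z := fun z hz => hp' hz
  set D : ℝ := M - g p' with hD
  have hgx : g x₀ ≤ M := hgK _ (hGK hx₀G)
  have hpD : M - g p ≤ D := by have := hp'min p (hGK hpG); linarith
  have hDpos : 0 < D := by
    have : 0 < δ * (M - g p) := by linarith
    have := pos_of_mul_pos_right this hδpos.le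
    linarith
  have hxD : M - g x₀ ≤ δ * D := hcon.le.trans (by gcongr)
  -- normalisation
  obtain ⟨L, P, hLdet, hPK, hlam, hrec⟩ := simplex_normalisation hKc (p₀ := x₀)
    (by rw [hKitr]; exact hx₀G)
  -- lower bound for the depth
  have hdepth : 1 ≤ L.det ^ 2 * (16 * N ^ 2 * m) ^ n := by
    by_contra hlt
    push Not at hlt
    set k : ℝ := 8 * N ^ 2 * m with hk
    have hkpos : 0 < k := by positivity
    set r : ℝ := 1 / (2 * N) with hr
    have hrpos : 0 < r := by positivity
    set q₁ : Euc n → ℝ := fun z => ∑ i, ((-rowFun L i x₀ - r) + rowFun L i z) ^ 2 with hq₁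
    set q : Euc n → ℝ := fun z => (c - k * r ^ 2 + f z) + k * q₁ z with hq
    have hq₁c : Continuous q₁ := by fun_prop
    have hqc : Continuous q := by fun_prop
    have hquad := (IsQuad.affine (c - k * r ^ 2) f).add
      ((IsQuad.sum Finset.univ fun i => IsQuad.sq (-rowFun L i x₀ - r) (rowFun L i)).const_mul k)
    have hcoord : ∀ z, q₁ z ≤ r ^ 2 → z ∈ K := by
      intro z hz
      have hco : ∀ i, 0 ≤ rowFun L i (z - x₀) ∧ rowFun L i (z - x₀) ≤ 2 * r := by
        intro i
        have h1 : ((-rowFun L i x₀ - r) + rowFun L i z) ^ 2 ≤ r ^ 2 :=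
          (Finset.single_le_sum (f := fun i => ((-rowFun L i x₀ - r) + rowFun L i z) ^ 2)
            (fun i _ => sq_nonneg _) (Finset.mem_univ i)).trans hz
        have h2 := abs_le.1 (abs_le_of_sq_le_sq h1 hrpos.le)
        rw [map_sub]
        constructor <;> linarith [h2.1, h2.2]
      have h3 := simplex_mem hKconv (hGK hx₀G) hPK (fun i => (hco i).1) (by
        calc ∑ i, rowFun L i (z - x₀) ≤ ∑ _i : Fin n, 2 * r := Finset.sum_le_sum fun i _ => (hco i).2
          _ = 1 := by
            rw [Finset.sum_const, Finset.card_univ, Fintype.card_fin, nsmul_eq_mul, hr, ← hNdef]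
            field_simp)
      rw [← hrec] at h3
      simpa using h3
    set E : Set (Euc n) := {z | q₁ z ≤ r ^ 2} with hE
    have hEK : E ⊆ K := hcoord
    have hEc : IsCompact E := hKc.of_isClosed_subset (isClosed_le hq₁c continuous_const) hEK
    -- the center
    set ctr : Euc n := x₀ + ∑ i, r • (P i - x₀) with hctr
    have hctr₁ : q₁ ctr = 0 := by
      have hinj : ∀ i, rowFun L i (ctr - x₀) = r := by
        have e0 := hrec (ctr - x₀)
        -- the map `d ↦ (rowFun L i d)` is invertible
        have hsurj : ∃ d : Euc n, ∀ i, rowFun L i d = r := by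
          refine ⟨WithLp.toLp 2 (L⁻¹.mulVec fun _ => r), fun i => ?_⟩
          rw [rowFun_apply]
          simp only [Matrix.mulVec_mulVec]
          rw [Matrix.mul_nonsing_inv _ (isUnit_iff_ne_zero.2 hLdet), Matrix.one_mulVec]
        obtain ⟨d, hd⟩ := hsurj
        have e1 := hrec d
        simp only [hd] at e1
        have e2 : ctr - x₀ = d := by rw [hctr, add_sub_cancel_left, ← e1]
        rw [e2]; exact hd
      simp only [hq₁]
      refine Finset.sum_eq_zero fun i _ => ?_
      have := hinj i
      rw [map_sub] at this
      have : -rowFun L i x₀ - r + rowFun L i ctr = 0 := by linarith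
      rw [this]; ring
    have hctrE : ctr ∈ E := by simp only [hE, Set.mem_ofPred_eq, hctr₁]; positivity
    obtain ⟨z₀, hz₀E, hz₀⟩ := hEc.exists_isMaxOn ⟨ctr, hctrE⟩
      ((hvK.mono hEK).sub hqc.continuousOn)
    have hEitr : ∀ z, q₁ z < r ^ 2 → z ∈ G := by
      intro z hz
      rw [← hKitr, mem_interior]
      exact ⟨{z | q₁ z < r ^ 2}, fun y hy => hcoord y (le_of_lt hy),
        isOpen_lt hq₁c continuous_const, hz⟩
    have hctrG : ctr ∈ G := hEitr _ (by rw [hctr₁]; positivity)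
    have hz₀max : v ctr - q ctr ≤ v z₀ - q z₀ := hz₀ hctrE
    have hpos : 0 < v ctr - q ctr := by
      have h1 := hlow ctr hctrG.1
      have h2 : k * r ^ 2 = 2 * m := by rw [hk, hr]; field_simp; norm_num
      simp only [hq, hctr₁]
      linarith
    have hz₀lt : q₁ z₀ < r ^ 2 := by
      by_contra hge
      push Not at hge
      have h1 := hle z₀ (hEK hz₀E)
      have h2 : k * r ^ 2 ≤ k * q₁ z₀ := by gcongr
      simp only [hq] at hz₀max hpos
      linarith
    have hz₀G := hEitr z₀ hz₀lt
    have hlm : IsLocalMax (fun y => v y - q y) z₀ := by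
      have : {z | q₁ z < r ^ 2} ∈ nhds z₀ := (isOpen_lt hq₁c continuous_const).mem_nhds hz₀lt
      filter_upwards [this] with y hy
      exact hz₀ (show y ∈ E from le_of_lt hy)
    have h1 := det_ge_of_max hMA.isOpen hMA.conv hz₀G.1 (hMA.c2At hz₀G.1)
      (by linarith [hMA.one_le z₀ hz₀G.1]) hquad hlm
      (cmpMat_posSemidef L 0 (τ := 2 * k) (B := 0) (by positivity) le_rfl).isHermitian
      (by
        intro d
        rw [cmpMat_form, ← Finset.mul_sum]
        ring)
    rw [cmpMat_det _ _ (by positivity)] at h1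
    have h2 := hMA.one_le z₀ hz₀G.1
    simp only [zero_div, zero_mul, add_zero, mul_one] at h1
    have h3 : 2 * k = 16 * N ^ 2 * m := by rw [hk]; ring
    rw [h3] at h1
    linarith
  -- the barrier
  set τ : ℝ := m / (4 * N) with hτ
  have hτpos : 0 < τ := by positivity
  set B : ℝ := m * B₀ with hB
  have hBnn : 0 ≤ B := by positivity
  set a : Fin n → ℝ := fun i => -(g (P i - x₀)) / D with ha
  have hga : ∀ d, -g d / D = ∑ i, a i * rowFun L i d := by
    intro d
    conv_lhs => rw [hrec d]
    simp only [map_sum, map_smul, smul_eq_mul, ha, neg_div, Finset.sum_div, ← Finset.sum_neg_distrib]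
    exact Finset.sum_congr rfl fun i _ => by ring
  have hanorm : 1 / (4 * N) ≤ ∑ i, a i ^ 2 := by
    have h1 : 1 / 2 ≤ ∑ i, a i * rowFun L i (p' - x₀) := by
      rw [← hga, map_sub, le_div_iff₀ hDpos]
      have : δ * D ≤ 1 / 4 * D := by gcongr
      linarith
    have h2 := Finset.sum_mul_sq_le_sq_mul_sq Finset.univ a (fun i => rowFun L i (p' - x₀))
    have h3 : ∑ i, (rowFun L i (p' - x₀)) ^ 2 ≤ N := by
      calc ∑ i, (rowFun L i (p' - x₀)) ^ 2 ≤ ∑ _i : Fin n, (1:ℝ) :=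
            Finset.sum_le_sum fun i _ => (sq_le_one_iff_abs_le_one _).2 (hlam p' hp'K i)
        _ = N := by simp [hNdef]
    have h4 : (1 / 2 : ℝ) ^ 2 ≤ (∑ i, a i * rowFun L i (p' - x₀)) ^ 2 := by gcongr
    have h5 : (0:ℝ) ≤ ∑ i, a i ^ 2 := Finset.sum_nonneg fun i _ => sq_nonneg _
    have h6 : (1 / 2 : ℝ) ^ 2 ≤ (∑ i, a i ^ 2) * N := h4.trans (h2.trans (by gcongr))
    rw [div_le_iff₀ (by positivity)]
    linarith
  set W₁ : Euc n → ℝ := fun z => ∑ i, (-rowFun L i x₀ + rowFun L i z) ^ 2 with hW₁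
  set s : Euc n → ℝ := fun z => M / D + (-(1 / D)) * g z with hs
  set W : Euc n → ℝ := fun z => (c + f z) + (τ / 2 * (W₁ z - N) + B / 2 * ((s z) ^ 2 - s z)) with hW
  have hWc : Continuous W := by fun_prop
  have hsK : ∀ z ∈ K, 0 ≤ s z ∧ s z ≤ 1 := by
    intro z hz
    have e : s z = (M - g z) / D := by simp only [hs]; ring
    rw [e]
    refine ⟨div_nonneg (by linarith [hgK z hz]) hDpos.le, ?_⟩
    rw [div_le_one hDpos]
    linarith [hp'min z hz]
  have hsx : s x₀ ≤ δ := by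
    have e : s x₀ = (M - g x₀) / D := by simp only [hs]; ring
    rw [e, div_le_iff₀ hDpos]
    exact hxD
  have hW₁K : ∀ z ∈ K, W₁ z ≤ N := by
    intro z hz
    calc W₁ z ≤ ∑ _i : Fin n, (1:ℝ) := Finset.sum_le_sum fun i _ => by
            have := hlam z hz i
            rw [map_sub] at this
            refine (sq_le_one_iff_abs_le_one _).2 ?_
            rwa [neg_add_eq_sub]
      _ = N := by simp [hNdef]
  have hWle : ∀ z ∈ K, W z ≤ c + f z := by
    intro z hz
    have h1 : τ / 2 * (W₁ z - N) ≤ 0 :=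
      mul_nonpos_of_nonneg_of_nonpos (by positivity) (by linarith [hW₁K z hz])
    have h2 : B / 2 * ((s z) ^ 2 - s z) ≤ 0 := by
      refine mul_nonpos_of_nonneg_of_nonpos (by positivity) ?_
      nlinarith [hsK z hz]
    simp only [hW]
    linarith
  have hWx : v x₀ < W x₀ := by
    have h0 : W₁ x₀ = 0 := by simp [hW₁]
    have h1 : τ / 2 * (W₁ x₀ - N) = -(m / 8) := by
      rw [h0, hτ]; field_simp; ring
    have h2 : -(m / 16) ≤ B / 2 * ((s x₀) ^ 2 - s x₀) := by
      have e1 : B / 2 * (-δ) ≤ B / 2 * ((s x₀) ^ 2 - s x₀) := by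
        gcongr
        nlinarith [sq_nonneg (s x₀)]
      have e2 : B / 2 * (-δ) = -(m / 2 * (B₀ * δ)) := by rw [hB]; ring
      have e3 : m / 2 * (B₀ * δ) ≤ m / 2 * (1 / 8) := by gcongr
      linarith
    simp only [hW]
    linarith
  obtain ⟨z₀, hz₀K, hz₀⟩ := hKc.exists_isMinOn ⟨x₀, hGK hx₀G⟩ (hvK.sub hWc.continuousOn)
  have hz₀min : v z₀ - W z₀ ≤ v x₀ - W x₀ := hz₀ (hGK hx₀G)
  have hz₀G : z₀ ∈ G := hKG z₀ hz₀K (by linarith [hWle z₀ hz₀K])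
  have hlm : IsLocalMin (fun y => v y - W y) z₀ := by
    filter_upwards [hGo.mem_nhds hz₀G] with y hy
    exact hz₀ (hGK hy)
  have hquad : IsQuad W (fun d => τ * ∑ i, (rowFun L i d) ^ 2 + B * (∑ i, a i * rowFun L i d) ^ 2) := by
    have h1 := (IsQuad.affine (c - τ / 2 * N - B / 2 * (M / D)) (f + (B / 2 * (1 / D)) • g)).add
      (((IsQuad.sum Finset.univ fun i => IsQuad.sq (-rowFun L i x₀) (rowFun L i)).const_mul
        (τ / 2)).add ((IsQuad.sq (M / D) ((-(1 / D)) • g)).const_mul (B / 2)))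
    convert h1 using 1
    · ext z
      simp only [hW, hW₁, hs, _root_.add_apply, _root_.smul_apply, smul_eq_mul]
      ring
    · ext d
      rw [← hga, ← Finset.mul_sum]
      simp only [_root_.smul_apply, smul_eq_mul]
      ring
  have hdetval := cmpMat_det L a (τ := τ) (B := B) hτpos.ne'
  have hbig : Λ < (cmpMat L a τ B).det := by
    rw [hdetval]
    have e1 : B / τ * (1 / (4 * N)) = B₀ := by rw [hB, hτ]; field_simp
    have e2 : B₀ ≤ B / τ * ∑ i, a i ^ 2 := by
      rw [← e1]
      have : 0 ≤ B / τ := by positivity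
      gcongr
    have e3 : L.det ^ 2 * τ ^ n * (64 * N ^ 3) ^ n = L.det ^ 2 * (16 * N ^ 2 * m) ^ n := by
      rw [mul_assoc, ← mul_pow]
      congr 2
      rw [hτ]; field_simp; norm_num
    have e4 : L.det ^ 2 * τ ^ n * (1 + B₀) ≤
        L.det ^ 2 * (τ ^ n * (1 + B / τ * ∑ i, a i ^ 2)) := by
      rw [mul_assoc]; gcongr
    have e5 : 0 < L.det ^ 2 * τ ^ n := by positivity
    have e6 : |Λ| * 1 ≤ |Λ| * (L.det ^ 2 * τ ^ n * (64 * N ^ 3) ^ n) := by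
      rw [e3]; gcongr
    have e7 : L.det ^ 2 * τ ^ n * B₀ = |Λ| * (L.det ^ 2 * τ ^ n * (64 * N ^ 3) ^ n) := by
      rw [hB₀]; ring
    have := le_abs_self Λ
    linarith
  have hdpos : 0 < (cmpMat L a τ B).det := by
    rw [hdetval]
    have : 0 ≤ B / τ * ∑ i, a i ^ 2 :=
      mul_nonneg (by positivity) (Finset.sum_nonneg fun i _ => sq_nonneg _)
    positivity
  have h1 := det_le_of_min (hMA.c2At hz₀G.1) hquad hlm (cmpMat_posSemidef L a hτpos.le hBnn) hdpos
    (fun d => (cmpMat_form L a τ B d).symm)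
  have h2 := hMA.le z₀ hz₀G.1
  linarith

/-- The conclusion of `section_core`. -/
def SectionCore (n : ℕ) (Λ δ : ℝ) : Prop :=
    ∀ (Ω : Set (Euc n)) (v : Euc n → ℝ), MongeAmpere Λ Ω v →
    ∀ (c : ℝ) (f : Euc n →L[ℝ] ℝ), (∀ z ∈ frontier Ω, c + f z ≤ v z) →
    ∀ m : ℝ, 0 < m → (∀ z ∈ Ω, c + f z - m ≤ v z) →
    ∀ x₀ ∈ Ω, v x₀ ≤ c + f x₀ - m / 4 →
    ∀ (g : Euc n →L[ℝ] ℝ) (M : ℝ), (∀ z ∈ Ω, v z < c + f z → g z ≤ M) →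
    ∀ p ∈ Ω, v p < c + f p → δ * (M - g p) ≤ M - g x₀

lemma iterate_step {n : ℕ} {Λ δ : ℝ} (hcore : SectionCore n Λ δ) (hδ0 : 0 < δ) (hδ1 : δ < 1)
    {Ω : Set (Euc n)} {v : Euc n → ℝ} (hMA : MongeAmpere Λ Ω v)
    {c₀ : ℝ} {f₀ : Euc n →L[ℝ] ℝ} (hu : ∀ z ∈ Ω, c₀ + f₀ z ≤ v z)
    {c₁ : ℝ} {f₁ : Euc n →L[ℝ] ℝ} {ε : ℝ} (hε : 0 < ε)
    (hfr : ∀ z ∈ frontier Ω, c₀ + f₀ z + ε * (c₁ + f₁ z) ≤ v z)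
    {x₀ y : Euc n} (hx₀ : x₀ ∈ Ω) (hy : y ∈ Ω) (hx₀p : 0 < c₁ + f₁ x₀) (hyp : 0 < c₁ + f₁ y)
    (hyx : c₁ + f₁ y ≤ (c₁ + f₁ x₀) / 2)
    (hb : ∀ z ∈ Ω, v z < c₀ + f₀ z + ε * (c₁ + f₁ z) → c₁ + f₁ z < (1 + δ / 4) * (c₁ + f₁ x₀))
    (hvx : v x₀ - (c₀ + f₀ x₀) ≤ ε / 2 * (c₁ + f₁ x₀))
    (hvy : v y - (c₀ + f₀ y) ≤ ε / 2 * (c₁ + f₁ y)) : False := by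
  have hev : ∀ z, c₀ + ε * c₁ + (f₀ + ε • f₁) z = c₀ + f₀ z + ε * (c₁ + f₁ z) := by
    intro z
    simp only [_root_.add_apply, _root_.smul_apply, smul_eq_mul]
    ring
  have hεx : 0 < ε * (c₁ + f₁ x₀) := by positivity
  have hεy : 0 < ε * (c₁ + f₁ y) := by positivity
  have h := hcore Ω v hMA (c₀ + ε * c₁) (f₀ + ε • f₁) (fun z hz => by rw [hev]; exact hfr z hz)
    (2 * ε * (c₁ + f₁ x₀)) (by positivity) (by
      intro z hz
      rw [hev]
      by_cases hlt : v z < c₀ + f₀ z + ε * (c₁ + f₁ z)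
      · have h1 := hb z hz hlt
        have h2 : c₁ + f₁ z ≤ 2 * (c₁ + f₁ x₀) := by
          have : (1 + δ / 4) * (c₁ + f₁ x₀) ≤ 2 * (c₁ + f₁ x₀) := by gcongr; linarith
          linarith
        have h3 : ε * (c₁ + f₁ z) ≤ ε * (2 * (c₁ + f₁ x₀)) := by gcongr
        linarith [hu z hz]
      · push Not at hlt
        linarith)
    x₀ hx₀ (by rw [hev]; linarith) f₁ ((1 + δ / 4) * (c₁ + f₁ x₀) - c₁)
    (fun z hz hlt => by rw [hev] at hlt; linarith [hb z hz hlt])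
    y hy (by rw [hev]; linarith)
  have h4 : 0 < δ * (c₁ + f₁ x₀) := by positivity
  have h5 : δ * ((c₁ + f₁ x₀) / 2) ≤ δ * ((1 + δ / 4) * (c₁ + f₁ x₀) - c₁ - f₁ y) := by
    have : 0 < δ / 4 * (c₁ + f₁ x₀) := by positivity
    gcongr
    linarith
  linarith

lemma iterate {n : ℕ} {Λ δ : ℝ} (hcore : SectionCore n Λ δ) (hδ0 : 0 < δ) (hδ1 : δ < 1)
    {Ω : Set (Euc n)} {v : Euc n → ℝ} (hMA : MongeAmpere Λ Ω v)
    {c₀ : ℝ} {f₀ : Euc n →L[ℝ] ℝ} (hu : ∀ z ∈ Ω, c₀ + f₀ z ≤ v z)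
    (hufr : ∀ z ∈ frontier Ω, c₀ + f₀ z ≤ v z)
    {c₁ : ℝ} {f₁ : Euc n →L[ℝ] ℝ} {ε : ℝ} (hε : 0 < ε)
    (hfr : ∀ z ∈ frontier Ω, c₀ + f₀ z + ε * (c₁ + f₁ z) ≤ v z)
    {y : Euc n} (hy : y ∈ Ω) (hyp : 0 < c₁ + f₁ y) (N : ℕ) :
    ∀ x₀ ∈ Ω, 0 < c₁ + f₁ x₀ → c₁ + f₁ y ≤ (c₁ + f₁ x₀) / 2 →
    (∀ z ∈ Ω, c₁ + f₁ z < (1 + δ / 4) ^ (N + 1) * (c₁ + f₁ x₀)) →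
    v x₀ - (c₀ + f₀ x₀) ≤ (1 / 2) ^ (N + 1) * ε * (c₁ + f₁ x₀) →
    v y - (c₀ + f₀ y) ≤ (1 / 2) ^ (N + 1) * ε * (c₁ + f₁ y) → False := by
  have hfr' : ∀ N : ℕ, ∀ z ∈ frontier Ω, c₀ + f₀ z + (1 / 2) ^ N * ε * (c₁ + f₁ z) ≤ v z := by
    intro N z hz
    have h1 : ((1:ℝ) / 2) ^ N ≤ 1 := pow_le_one₀ (by norm_num) (by norm_num)
    have h2 := hufr z hz
    have h3 := hfr z hz
    rcases le_total 0 (c₁ + f₁ z) with h | h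
    · have : (1 / 2) ^ N * ε * (c₁ + f₁ z) ≤ 1 * ε * (c₁ + f₁ z) := by gcongr
      linarith
    · have : (1 / 2) ^ N * ε * (c₁ + f₁ z) ≤ 0 :=
        mul_nonpos_of_nonneg_of_nonpos (by positivity) h
      linarith
  induction N with
  | zero =>
    intro x₀ hx₀ hx₀p hyx hb hvx hvy
    refine iterate_step hcore hδ0 hδ1 hMA hu hε hfr hx₀ hy hx₀p hyp hyx
      (fun z hz _ => by simpa using hb z hz) ?_ ?_
    · linarith
    · linarith
  | succ N ih =>
    intro x₀ hx₀ hx₀p hyx hb hvx hvy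
    by_cases hcase : ∀ z ∈ Ω, v z < c₀ + f₀ z + (1 / 2) ^ (N + 1) * ε * (c₁ + f₁ z) →
        c₁ + f₁ z < (1 + δ / 4) * (c₁ + f₁ x₀)
    · refine iterate_step hcore hδ0 hδ1 hMA hu (ε := (1 / 2) ^ (N + 1) * ε) (by positivity)
        (hfr' (N + 1)) hx₀ hy hx₀p hyp hyx hcase ?_ ?_
      · rw [pow_succ] at hvx; linarith
      · rw [pow_succ] at hvy; linarith
    · push Not at hcase
      obtain ⟨x₁, hx₁, hlt, hge⟩ := hcase
      have h1 : 0 < δ / 4 * (c₁ + f₁ x₀) := by positivity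
      refine ih x₁ hx₁ (by linarith) (by linarith) ?_ (by linarith) ?_
      · intro z hz
        calc c₁ + f₁ z < (1 + δ / 4) ^ (N + 1 + 1) * (c₁ + f₁ x₀) := hb z hz
          _ = (1 + δ / 4) ^ (N + 1) * ((1 + δ / 4) * (c₁ + f₁ x₀)) := by ring
          _ ≤ _ := by gcongr
      · have h2 : 0 < (1 / 2) ^ (N + 1) * ε * (c₁ + f₁ y) := by positivity
        rw [pow_succ] at hvy
        linarith

/-- `v ≤ 0` in the interior. -/
lemma MongeAmpere.nonpos {n : ℕ} (hn : 1 ≤ n) {Λ : ℝ} {Ω : Set (Euc n)} {v : Euc n → ℝ}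
    (h : MongeAmpere Λ Ω v) (h0 : ∀ z ∈ frontier Ω, v z = 0) : ∀ z ∈ closure Ω, v z ≤ 0 := by
  intro z hz
  obtain ⟨z₀, hz₀, hmax⟩ := h.bdd.isCompact_closure.exists_isMaxOn ⟨z, hz⟩ h.cont
  have h1 : v z ≤ v z₀ := hmax hz
  by_cases hf : z₀ ∈ frontier Ω
  · linarith [h0 z₀ hf]
  exfalso
  have hzΩ := h.mem_of_closure hz₀ hf
  have hlm : IsLocalMax (fun y => v y - ((0:ℝ) + (0 : Euc n →L[ℝ] ℝ) y)) z₀ := by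
    filter_upwards [h.isOpen.mem_nhds hzΩ] with y hy
    have : v y ≤ v z₀ := hmax (subset_closure hy)
    simpa using this
  have h2 := det_ge_of_max h.isOpen h.conv hzΩ (h.c2At hzΩ)
    (by linarith [h.one_le z₀ hzΩ]) (IsQuad.affine 0 0) hlm
    (A := 0) (Matrix.isHermitian_zero) (by intro d; simp)
  haveI : Nonempty (Fin n) := Fin.pos_iff_nonempty.1 (by omega)
  rw [Matrix.det_zero] at h2
  linarith [h.one_le z₀ hzΩ]

/-- Quantitative negativity. -/
lemma MongeAmpere.le_neg {n : ℕ} (hn : 1 ≤ n) {Λ : ℝ} {Ω : Set (Euc n)} {v : Euc n → ℝ}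
    (h : MongeAmpere Λ Ω v) (h0 : ∀ z ∈ closure Ω, v z ≤ 0) {x : Euc n} {ρ : ℝ} (hρ : 0 < ρ)
    (hb : Metric.closedBall x ρ ⊆ Ω) : v x ≤ -(ρ ^ 2 / 4) := by
  set q₁ : Euc n → ℝ := fun z => ∑ i, (-rowFun (1 : Matrix (Fin n) (Fin n) ℝ) i x + rowFun 1 i z) ^ 2
    with hq₁
  have hq₁e : ∀ z, q₁ z = ‖z - x‖ ^ 2 := by
    intro z
    rw [EuclideanSpace.norm_sq_eq]
    refine Finset.sum_congr rfl fun i _ => ?_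
    rw [rowFun_apply, rowFun_apply]
    simp [neg_add_eq_sub]
  set q : Euc n → ℝ := fun z => (-(ρ ^ 2 / 4) + (0 : Euc n →L[ℝ] ℝ) z) + 1 / 4 * q₁ z with hq
  have hqc : Continuous q := by fun_prop
  have hquad := (IsQuad.affine (-(ρ ^ 2 / 4)) (0 : Euc n →L[ℝ] ℝ)).add
      ((IsQuad.sum Finset.univ fun i => IsQuad.sq (-rowFun (1 : Matrix (Fin n) (Fin n) ℝ) i x)
        (rowFun 1 i)).const_mul (1 / 4))
  have hxb : x ∈ Metric.closedBall x ρ := Metric.mem_closedBall_self hρ.le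
  obtain ⟨z₀, hz₀, hmax⟩ := (isCompact_closedBall x ρ).exists_isMaxOn ⟨x, hxb⟩
    ((h.c2.continuousOn.mono hb).sub hqc.continuousOn)
  have h1 : v x - q x ≤ v z₀ - q z₀ := hmax hxb
  have hqx : q x = -(ρ ^ 2 / 4) := by simp [hq, hq₁e]
  by_cases hlt : dist z₀ x < ρ
  · exfalso
    have hlm : IsLocalMax (fun y => v y - q y) z₀ := by
      filter_upwards [Metric.isOpen_ball.mem_nhds (Metric.mem_ball.2 hlt)] with y hy
      exact hmax (Metric.ball_subset_closedBall hy)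
    have hzΩ := hb hz₀
    have h2 := det_ge_of_max h.isOpen h.conv hzΩ (h.c2At hzΩ)
      (by linarith [h.one_le z₀ hzΩ]) hquad hlm
      (cmpMat_posSemidef 1 0 (τ := 1 / 2) (B := 0) (by positivity) le_rfl).isHermitian
      (by
        intro d
        rw [cmpMat_form, ← Finset.mul_sum]
        simp
        ring)
    rw [cmpMat_det _ _ (by positivity)] at h2
    simp at h2
    have h3 := h.one_le z₀ hzΩ
    have h4 : ((2:ℝ) ^ n)⁻¹ < 1 := inv_lt_one_of_one_lt₀ (one_lt_pow₀ (by norm_num) (by omega))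
    linarith
  · have h2 : v z₀ ≤ 0 := h0 _ (subset_closure (hb hz₀))
    have h3 : q z₀ = -(ρ ^ 2 / 4) + 1 / 4 * ‖z₀ - x‖ ^ 2 := by simp [hq, hq₁e]
    push Not at hlt
    rw [dist_eq_norm] at hlt
    have h4 : ρ ^ 2 ≤ ‖z₀ - x‖ ^ 2 := by gcongr
    linarith

lemma closedBall_subset_of_infDist {n : ℕ} {Ω : Set (Euc n)} (ho : IsOpen Ω) {x : Euc n}
    (hx : x ∈ Ω) {ρ : ℝ}
    (hρ : 0 < ρ) (h : ρ < Metric.infDist x (frontier Ω)) : Metric.closedBall x ρ ⊆ Ω := by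
  have hpc : IsPreconnected (Metric.closedBall x ρ) := (convex_closedBall x ρ).isPreconnected
  refine hpc.subset_of_closure_inter_subset ho ⟨x, Metric.mem_closedBall_self hρ.le, hx⟩ ?_
  rintro w ⟨hw, hwb⟩
  by_contra hwΩ
  have hwf : w ∈ frontier Ω := by rw [ho.frontier_eq]; exact ⟨hw, hwΩ⟩
  have h1 := Metric.infDist_le_dist_of_mem (x := x) hwf
  rw [Metric.mem_closedBall, dist_comm] at hwb
  linarith

lemma MongeAmpere.diffAt {n : ℕ} {Λ : ℝ} {Ω : Set (Euc n)} {v : Euc n → ℝ}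
    (h : MongeAmpere Λ Ω v) {x : Euc n} (hx : x ∈ Ω) : DifferentiableAt ℝ v x :=
  (h.c2At hx).differentiableAt (by norm_num)

lemma MongeAmpere.support {n : ℕ} {Λ : ℝ} {Ω : Set (Euc n)} {v : Euc n → ℝ}
    (h : MongeAmpere Λ Ω v) {x : Euc n} (hx : x ∈ Ω) :
    ∀ z ∈ closure Ω, v x - fderiv ℝ v x x + fderiv ℝ v x z ≤ v z := by
  intro z hz
  refine ContinuousWithinAt.closure_le (f := fun z => v x - fderiv ℝ v x x + fderiv ℝ v x z)
    (g := v) (s := Ω) hz (Continuous.continuousWithinAt (by fun_prop))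
    ((h.cont z hz).mono subset_closure) ?_
  intro y hy
  have := grad_ineq h.conv hx hy (h.diffAt hx)
  rw [map_sub] at this
  linarith

lemma MongeAmpere.convClosure {n : ℕ} {Λ : ℝ} {Ω : Set (Euc n)} {v : Euc n → ℝ}
    (h : MongeAmpere Λ Ω v) {x : Euc n} (hx : x ∈ Ω) {b : Euc n} (hb : b ∈ closure Ω)
    {t : ℝ} (ht0 : 0 < t) (ht1 : t < 1) :
    x + t • (b - x) ∈ Ω ∧ v (x + t • (b - x)) ≤ (1 - t) * v x + t * v b := by
  have key : ∀ y, x + t • (y - x) = (1 - t) • x + t • y := fun y => by module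
  have hmem : x + t • (b - x) ∈ Ω := by
    have := h.conv.1.combo_interior_closure_mem_interior (x := x) (y := b)
      (by rwa [h.isOpen.interior_eq]) hb (a := 1 - t) (b := t) (by linarith) ht0.le (by ring)
    rw [h.isOpen.interior_eq] at this
    rwa [key]
  refine ⟨hmem, ?_⟩
  refine ContinuousWithinAt.closure_le (f := fun b => v (x + t • (b - x)))
    (g := fun b => (1 - t) * v x + t * v b) (s := Ω) hb ?_ ?_ ?_
  · have h1 : ContinuousAt v (x + t • (b - x)) :=
      h.c2.continuousOn.continuousAt (h.isOpen.mem_nhds hmem)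
    have h2 : ContinuousAt (fun b => x + t • (b - x)) b := by fun_prop
    exact (ContinuousAt.comp (f := fun b => x + t • (b - x)) (g := v) h1 h2).continuousWithinAt
  · exact continuousWithinAt_const.add
      (continuousWithinAt_const.mul ((h.cont b hb).mono subset_closure))
  · intro y hy
    have := h.conv.2 hx hy (sub_nonneg.2 ht1.le) ht0.le (sub_add_cancel 1 t)
    simp only [smul_eq_mul] at this
    simp only [key]
    exact this

/-- Lower bound for the height of the boundary over tangent planes at interior points. -/
lemma boundary_lower {n : ℕ} (hn : 1 ≤ n) {Λ δ : ℝ} (hcore : SectionCore n Λ δ) (hδ0 : 0 < δ)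
    (hδ1 : δ < 1) {ρ : ℝ} (hρ : 0 < ρ) : ∃ c₁ : ℝ, 0 < c₁ ∧
    ∀ (Ω : Set (Euc n)) (v : Euc n → ℝ), MongeAmpere Λ Ω v → Ω ⊆ Metric.ball 0 (n : ℝ) →
    (∀ z ∈ frontier Ω, v z = 0) → ∀ x ∈ Ω, Metric.closedBall x ρ ⊆ Ω → ∀ b ∈ frontier Ω,
      v x - fderiv ℝ v x x + fderiv ℝ v x b + c₁ ≤ v b := by
  have hN : (0:ℝ) < n := by exact_mod_cast (by omega : 0 < n)
  obtain ⟨N, hNp⟩ := pow_unbounded_of_one_lt (1 + 2 * n / ρ) (show 1 < 1 + δ / 4 by linarith)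
  have hNp' : 1 + 2 * n / ρ < (1 + δ / 4) ^ (N + 1) :=
    hNp.trans_le (pow_le_pow_right₀ (by linarith) (by omega))
  set κ : ℝ := (1 / 2) ^ (N + 1) with hκ
  have hκ0 : 0 < κ := by positivity
  have hκ1 : κ ≤ 1 := pow_le_one₀ (by norm_num) (by norm_num)
  refine ⟨κ * ρ ^ 2 / 8, by positivity, ?_⟩
  intro Ω v hMA hsub h0 x hx hball b hb
  by_contra hcon
  push Not at hcon
  have hbv := h0 b hb
  have hbc : b ∈ closure Ω := frontier_subset_closure hb
  have hnp := hMA.nonpos hn h0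
  have hA := hMA.le_neg hn hnp hρ hball
  have hsup := hMA.support hx
  set f₀ := fderiv ℝ v x with hf₀
  set A : ℝ := -v x with hAd
  have hApos : 0 < A := by have : 0 < ρ ^ 2 / 4 := by positivity
                           linarith
  have hbd : ∀ z ∈ Ω, A + f₀ x - f₀ z ≤ (1 + 2 * n / ρ) * A := by
    intro z hz
    have h1 : x - (ρ / (2 * n)) • (z - x) ∈ Ω := by
      apply hball
      rw [Metric.mem_closedBall, dist_eq_norm, sub_sub_cancel_left, norm_neg, norm_smul,
        Real.norm_of_nonneg (by positivity)]
      have h2 : ‖z - x‖ ≤ 2 * n := by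
        have e1 := mem_ball_zero_iff.1 (hsub hz)
        have e2 := mem_ball_zero_iff.1 (hsub hx)
        have := norm_sub_le z x
        linarith
      calc ρ / (2 * n) * ‖z - x‖ ≤ ρ / (2 * n) * (2 * n) := by gcongr
        _ = ρ := by field_simp
    have h3 := hsup _ (subset_closure h1)
    have h4 := hnp _ (subset_closure h1)
    simp only [map_sub, map_smul, smul_eq_mul] at h3
    have h5 : -(ρ / (2 * n) * (f₀ z - f₀ x)) ≤ A := by linarith
    have h6 : 2 * n / ρ * -(ρ / (2 * n) * (f₀ z - f₀ x)) ≤ 2 * n / ρ * A := by gcongr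
    have h7 : 2 * n / ρ * -(ρ / (2 * n) * (f₀ z - f₀ x)) = f₀ x - f₀ z := by field_simp; ring
    linarith
  set β : ℝ := A + f₀ x - f₀ b with hβ
  have hβ0 : 0 ≤ β := by have := hsup b hbc; linarith
  have hβκ : β < κ * A / 2 := by
    have : κ * (ρ ^ 2 / 4) ≤ κ * A := by gcongr; linarith
    linarith
  have hβA : β < A / 2 := by
    have : κ * A ≤ 1 * A := by gcongr
    linarith
  set t : ℝ := (A / 2) / (A - β) with ht
  have hAβ : 0 < A - β := by linarith
  have ht0 : 0 < t := by positivity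
  have ht1 : t < 1 := by rw [ht, div_lt_one hAβ]; linarith
  have htm : t * (A - β) = A / 2 := by rw [ht]; field_simp
  obtain ⟨hy, hvy⟩ := hMA.convClosure hx hbc ht0 ht1
  set y := x + t • (b - x) with hyd
  have hfy : f₀ y = f₀ x + t * (f₀ b - f₀ x) := by simp [hyd]
  have hφx : -(v x - f₀ x) + (-f₀) x = A := by simp [hAd]; ring
  have hφ : ∀ z, -(v x - f₀ x) + (-f₀) z = A + f₀ x - f₀ z := by intro z; simp [hAd]; ring
  have hφy : -(v x - f₀ x) + (-f₀) y = A / 2 := by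
    rw [hφ, hfy, ← htm, hβ]
    have : t * (A - (A + f₀ x - f₀ b)) = A / 2 := htm
    have h9 : t * (f₀ b - f₀ x) = A / 2 := by linarith
    linarith
  refine iterate hcore hδ0 hδ1 hMA (c₀ := v x - f₀ x) (f₀ := f₀)
    (fun z hz => hsup z (subset_closure hz)) (fun z hz => hsup z (frontier_subset_closure hz))
    (c₁ := -(v x - f₀ x)) (f₁ := -f₀) one_pos ?_ hy (by rw [hφy]; positivity) N x hx
    (by rw [hφx]; exact hApos) (by rw [hφy, hφx]) ?_ ?_ ?_
  · intro z hz
    rw [h0 z hz, hφ, hAd]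
    linarith
  · intro z hz
    rw [hφx, hφ]
    exact (hbd z hz).trans_lt (by gcongr)
  · rw [hφx]
    have : 0 ≤ κ * 1 * A := by positivity
    linarith
  · rw [hφy, ← hκ]
    have h10 : t * β ≤ 1 * β := by gcongr
    have h11 : t * (f₀ b - f₀ x) = A / 2 := by
      have : t * (A - (A + f₀ x - f₀ b)) = A / 2 := htm
      linarith
    have h12 : t * (A - β) = t * A - t * β := by ring
    rw [hbv] at hvy
    rw [hfy]
    have h13 : (1 - t) * v x = -A + t * A := by rw [hAd]; ring
    linarith

/-- Sections of small height stay in the `ρ`-ball. -/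
lemma section_small {n : ℕ} (hn : 1 ≤ n) {Λ δ : ℝ} (hcore : SectionCore n Λ δ) (hδ0 : 0 < δ)
    (hδ1 : δ < 1) {ρ : ℝ} (hρ : 0 < ρ) {c₁ : ℝ} (hc₁ : 0 < c₁) : ∃ H : ℝ, 0 < H ∧
    ∀ (Ω : Set (Euc n)) (v : Euc n → ℝ), MongeAmpere Λ Ω v → Ω ⊆ Metric.ball 0 (n : ℝ) →
    ∀ x ∈ Ω, (∀ b ∈ frontier Ω, v x - fderiv ℝ v x x + fderiv ℝ v x b + c₁ ≤ v b) →
    ∀ z ∈ Ω, v z < v x - fderiv ℝ v x x + fderiv ℝ v x z + H → ‖z - x‖ < ρ := by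
  have hN : (0:ℝ) < n := by exact_mod_cast (by omega : 0 < n)
  obtain ⟨N, hNp⟩ := pow_unbounded_of_one_lt (2 * n / ρ) (show 1 < 1 + δ / 4 by linarith)
  have hNp' : 2 * n / ρ < (1 + δ / 4) ^ (N + 1) :=
    hNp.trans_le (pow_le_pow_right₀ (by linarith) (by omega))
  set κ : ℝ := (1 / 2) ^ (N + 1) with hκ
  have hκ0 : 0 < κ := by positivity
  set ε : ℝ := c₁ / (4 * n ^ 2) with hε
  have hε0 : 0 < ε := by positivity
  refine ⟨κ * ε * ρ ^ 2, by positivity, ?_⟩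
  intro Ω v hMA hsub x hx hbdry z hz hvz
  by_contra hcon
  push Not at hcon
  have hsup := hMA.support hx
  set f₀ := fderiv ℝ v x with hf₀
  set R := ‖z - x‖ with hR
  have hRpos : 0 < R := by linarith
  have hdist : ∀ y ∈ closure Ω, ‖y - x‖ ≤ 2 * n := by
    intro y hy
    have e1 : y ∈ Metric.closedBall (0 : Euc n) n :=
      closure_minimal (hsub.trans Metric.ball_subset_closedBall) Metric.isClosed_closedBall hy
    rw [mem_closedBall_zero_iff] at e1
    have e2 := mem_ball_zero_iff.1 (hsub hx)
    have := norm_sub_le y x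
    linarith
  set g : Euc n →L[ℝ] ℝ := innerSL ℝ (z - x) with hg
  have hφ : ∀ y, -g x + g y = ⟪z - x, y - x⟫ := by
    intro y
    simp only [hg, innerSL_apply_apply, inner_sub_right]
    ring
  have hφz : -g x + g z = R ^ 2 := by rw [hφ, real_inner_self_eq_norm_sq]
  have hφle : ∀ y, -g x + g y ≤ R * ‖y - x‖ := fun y => by
    rw [hφ]; exact real_inner_le_norm _ _
  obtain ⟨hy, hvy⟩ := hMA.convClosure hx (subset_closure hz) (t := 1 / 2) (by norm_num) (by norm_num)
  set y := x + (1 / 2 : ℝ) • (z - x) with hyd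
  have hφy : -g x + g y = R ^ 2 / 2 := by
    have : g y = g x + 1 / 2 * (g z - g x) := by simp [hyd]
    rw [this]; linarith
  have hfy : f₀ y = f₀ x + 1 / 2 * (f₀ z - f₀ x) := by simp [hyd]
  have hHR : κ * ε * ρ ^ 2 ≤ κ * ε * R ^ 2 := by gcongr
  refine iterate hcore hδ0 hδ1 hMA (c₀ := v x - f₀ x) (f₀ := f₀)
    (fun z hz => hsup z (subset_closure hz)) (fun z hz => hsup z (frontier_subset_closure hz))
    (c₁ := -g x) (f₁ := g) hε0 ?_ hy (by rw [hφy]; positivity) N z hz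
    (by rw [hφz]; positivity) (by rw [hφy, hφz]) ?_ ?_ ?_
  · intro w hw
    have h1 := hdist w (frontier_subset_closure hw)
    have h2 := hdist z (subset_closure hz)
    have h3 : ε * (-g x + g w) ≤ c₁ := by
      calc ε * (-g x + g w) ≤ ε * ((2 * n) * (2 * n)) := by
            gcongr
            exact (hφle w).trans (by gcongr)
        _ = c₁ := by rw [hε]; field_simp; norm_num
    linarith [hbdry w hw]
  · intro w hw
    rw [hφz]
    have h1 := hdist w (subset_closure hw)
    calc -g x + g w ≤ R * (2 * n) := (hφle w).trans (by gcongr)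
      _ = 2 * n / ρ * (ρ * R) := by field_simp
      _ ≤ 2 * n / ρ * (R * R) := by gcongr
      _ < (1 + δ / 4) ^ (N + 1) * (R * R) := by gcongr
      _ = _ := by ring
  · rw [hφz]; linarith
  · rw [hφy, hfy, ← hκ]
    linarith

/-- Engulfing: scaling the half-height section stays in the section. -/
lemma section_scale {n : ℕ} {Λ δ : ℝ} (hcore : SectionCore n Λ δ) (hδ0 : 0 < δ)
    (hδ1 : δ < 1) {Ω : Set (Euc n)} {v : Euc n → ℝ} (hMA : MongeAmpere Λ Ω v)
    {x : Euc n} (hx : x ∈ Ω) {h : ℝ} (hh : 0 < h)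
    (hb : ∀ b ∈ frontier Ω, v x - fderiv ℝ v x x + fderiv ℝ v x b + h ≤ v b)
    {z : Euc n} (hz : z ∈ Ω) (hvz : v z < v x - fderiv ℝ v x x + fderiv ℝ v x z + h / 2) :
    x + (1 - δ / 2)⁻¹ • (z - x) ∈ Ω ∧ v (x + (1 - δ / 2)⁻¹ • (z - x)) <
      v x - fderiv ℝ v x x + h + fderiv ℝ v x (x + (1 - δ / 2)⁻¹ • (z - x)) := by
  have hsup := hMA.support hx
  set f₀ := fderiv ℝ v x with hf₀
  set c : ℝ := v x - f₀ x + h with hc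
  set θ : ℝ := 1 - δ / 2 with hθ
  have hθ0 : 0 < θ := by linarith
  set z' := x + θ⁻¹ • (z - x) with hz'
  by_contra hcon
  set G : Set (Euc n) := {z ∈ Ω | v z < c + f₀ z} with hG
  have hfc : Continuous fun z => c + f₀ z := by fun_prop
  have hGo : IsOpen G := by
    have := (hMA.c2.continuousOn.sub hfc.continuousOn).isOpen_inter_preimage hMA.isOpen
      (isOpen_Iio (a := (0:ℝ)))
    have e : G = Ω ∩ (v - fun z => c + f₀ z) ⁻¹' Set.Iio 0 := by
      refine Set.ext fun z => ⟨fun h => ⟨h.1, ?_⟩, fun h => ⟨h.1, ?_⟩⟩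
      · exact sub_neg.2 h.2
      · exact sub_neg.1 h.2
    rw [e]
    exact this
  have hGconv : Convex ℝ G := by
    have h2 : ConvexOn ℝ Ω fun z => v z - (c + f₀ z) := by
      refine hMA.conv.sub ⟨hMA.conv.1, ?_⟩
      intro x _ y _ a b ha hb hab
      simp only [map_add, map_smul, smul_eq_mul]
      have : a = 1 - b := by linarith
      subst this
      linarith
    have := h2.convex_lt 0
    have e : G = {x ∈ Ω | v x - (c + f₀ x) < 0} := by
      refine Set.ext fun z => ⟨fun h => ⟨h.1, ?_⟩, fun h => ⟨h.1, ?_⟩⟩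
      · exact sub_neg.2 h.2
      · exact sub_neg.1 h.2
    rw [e]
    exact this
  obtain ⟨g, hg⟩ := geometric_hahn_banach_open_point hGconv hGo (x := z') hcon
  have hxG : v x < c + f₀ x := by linarith
  have hmain := hcore Ω v hMA c f₀ (fun w hw => by linarith [hb w hw]) h hh
    (fun w hw => by linarith [hsup w (subset_closure hw)]) z hz (by linarith) g (g z')
    (fun w hw hlt => (hg w ⟨hw, hlt⟩).le) x hx hxG
  have hlt := hg x ⟨hx, hxG⟩
  have hgz : g z - g x = θ * (g z' - g x) := by
    have : g z' = g x + θ⁻¹ * (g z - g x) := by simp [hz']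
    rw [this]; field_simp; ring
  have h1 : 0 < δ * (g z' - g x) := mul_pos hδ0 (by linarith)
  have h2 : θ * (g z' - g x) = (g z' - g x) - δ * (g z' - g x) / 2 := by rw [hθ]; ring
  linarith

/-- Uniform interior strict convexity: sections of height `2^{−j} H` about interior
points `x ∈ Ω_ρ` shrink geometrically, `S(v, 2^{−j}H, x) ⊆ B_{θ^j ρ}(x) ⊆ Ω`. -/
theorem interior_sections_shrink (n : ℕ) (hn : 2 ≤ n) (fmax : ℝ) :
    ∃ θ : ℝ, 0 < θ ∧ θ < 1 ∧
      ∀ ρ : ℝ, 0 < ρ → ∃ H : ℝ, 0 < H ∧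
        ∀ (Ω : Set (Euc n)) (v f : Euc n → ℝ),
          IsOpen Ω → Convex ℝ Ω →
          Metric.ball 0 1 ⊆ Ω → Ω ⊆ Metric.ball 0 (n : ℝ) →
          ContDiffOn ℝ 2 v Ω → ContinuousOn v (closure Ω) → ConvexOn ℝ Ω v →
          (∀ z ∈ Ω, hessDet v z = f z ^ n) →
          (∀ z ∈ frontier Ω, v z = 0) →
          (∀ z ∈ Ω, 1 ≤ f z ∧ f z ≤ fmax) →
          ρ < Metric.diam Ω / 2 →
          ∀ j : ℕ, ∀ x ∈ Ω, ρ < Metric.infDist x (frontier Ω) →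
            secAt v ((2 : ℝ) ^ (-(j : ℤ)) * H) x Ω ⊆ Metric.ball x (θ ^ j * ρ) ∧
            Metric.ball x (θ ^ j * ρ) ⊆ Ω := by
  have hn1 : 1 ≤ n := by omega
  obtain ⟨δ, hδ0, hδ1, hcore⟩ := section_core n hn1 (fmax ^ n)
  have hθ0 : 0 < 1 - δ / 2 := by linarith
  have hθ1 : 1 - δ / 2 < 1 := by linarith
  refine ⟨1 - δ / 2, hθ0, hθ1, ?_⟩
  intro ρ hρ
  obtain ⟨c₁, hc₁, hbdry⟩ := boundary_lower hn1 hcore hδ0 hδ1 hρ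
  obtain ⟨H, hH, hsmall⟩ := section_small hn1 hcore hδ0 hδ1 hρ hc₁
  refine ⟨min c₁ H, lt_min hc₁ hH, ?_⟩
  intro Ω v f ho _ _ hsub hc2 hcont hconv hdet h0 hf _ j x hx hxρ
  have hMA : MongeAmpere (fmax ^ n) Ω v :=
    { isOpen := ho
      bdd := Metric.isBounded_ball.subset hsub
      c2 := hc2
      cont := hcont
      conv := hconv
      one_le := fun z hz => by rw [hdet z hz]; exact one_le_pow₀ (hf z hz).1
      le := fun z hz => by
        rw [hdet z hz]
        exact pow_le_pow_left₀ (by linarith [(hf z hz).1]) (hf z hz).2 n }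
  have hball := closedBall_subset_of_infDist ho hx hρ hxρ
  have hb := hbdry Ω v hMA hsub h0 x hx hball
  have hind : ∀ j : ℕ, ∀ z ∈ Ω,
      v z < v x - fderiv ℝ v x x + fderiv ℝ v x z + (1 / 2) ^ j * min c₁ H →
      ‖z - x‖ < (1 - δ / 2) ^ j * ρ := by
    intro j
    induction j with
    | zero =>
      intro z hz hvz
      rw [pow_zero, one_mul] at hvz ⊢
      exact hsmall Ω v hMA hsub x hx hb z hz (by linarith [min_le_right c₁ H])
    | succ j ih =>
      intro z hz hvz
      have hp : (0:ℝ) < (1 / 2) ^ j * min c₁ H := by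
        have := lt_min hc₁ hH
        positivity
      have hle : (1 / 2 : ℝ) ^ j * min c₁ H ≤ c₁ := by
        calc (1 / 2 : ℝ) ^ j * min c₁ H ≤ 1 * min c₁ H := by
              have := lt_min hc₁ hH
              gcongr
              exact pow_le_one₀ (by norm_num) (by norm_num)
          _ ≤ c₁ := by rw [one_mul]; exact min_le_left _ _
      obtain ⟨h1, h2⟩ := section_scale hcore hδ0 hδ1 hMA hx hp
        (fun b hbf => by linarith [hb b hbf]) hz (by rw [pow_succ] at hvz; linarith)
      have h3 := ih _ h1 (by linarith)
      rw [add_sub_cancel_left, norm_smul, norm_inv, Real.norm_of_nonneg hθ0.le,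
        inv_mul_lt_iff₀ hθ0] at h3
      rw [pow_succ]
      linarith
  refine ⟨?_, ?_⟩
  · rintro z ⟨hz, hvz⟩
    rw [Metric.mem_ball, dist_eq_norm]
    apply hind j z hz
    have e1 : ⟪gradient v x, z - x⟫ = fderiv ℝ v x (z - x) := by
      simp [gradient]
    have e2 : (2:ℝ) ^ (-(j : ℤ)) = (1 / 2) ^ j := by
      rw [zpow_neg, zpow_natCast, one_div, inv_pow]
    rw [e1, e2, map_sub] at hvz
    linarith
  · refine subset_trans ?_ hball
    refine (Metric.ball_subset_ball ?_).trans Metric.ball_subset_closedBall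
    have : (1 - δ / 2) ^ j ≤ 1 := pow_le_one₀ hθ0.le hθ1.le
    nlinarith
end
end

section
/- Let n ≥ 2, let Ω ⊆ ℝⁿ be a convex open set, and let v ∈ C²(Ω) ∩ C⁰(Ω̄) be a convex function with (det D²v)^{1/n} = f in Ω. Let h > 0 and x ∈ Ω be such that the closure of the section S(v, h, x) is contained in Ω and 1 ≤ f ≤ f_max on S(v, h, x) for a constant f_max. Suppose T is an invertible affine transform of ℝⁿ with B_{r₁}(ξ₁) ⊆ T S(v, h, x) ⊆ B_{r₂}(ξ₂) for some 0 < r₁ ≤ r₂ and ξ₁, ξ₂ ∈ ℝⁿ. Then: (a) r₁²/2 ≤ (det T)^{2/n} h ≤ (r₂²/2) f_max; (b) r₁/r₂ ≤ (8h)^{1/2} ‖T̆^{−1}‖ / diam(S(v, h, x)) ≤ (r₂/r₁) f_max^{1/2}; (c) ‖T^{−1}‖ ≤ diam(S(v, h, x)) / (2 r₁). -/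
open scoped RealInnerProductSpace
noncomputable section

/-- Operator norm of a matrix induced by the Euclidean vector norm. -/
def matOpNorm {n : ℕ} (A : Matrix (Fin n) (Fin n) ℝ) : ℝ :=
  ‖(Matrix.toEuclideanCLM (𝕜 := ℝ) A : Euc n →L[ℝ] Euc n)‖

open Matrix in
lemma herm_det_le {n : ℕ} (M : Matrix (Fin n) (Fin n) ℝ) (hM : M.IsHermitian) (a b : ℝ)
    (ha : 0 ≤ a)
    (hlo : ∀ y : Fin n → ℝ, a * (y ⬝ᵥ y) ≤ y ⬝ᵥ M *ᵥ y)
    (hup : ∀ y : Fin n → ℝ, y ⬝ᵥ M *ᵥ y ≤ b * (y ⬝ᵥ y)) : a ^ n ≤ M.det ∧ M.det ≤ b ^ n := by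
  have key : ∀ i, ∃ y : Fin n → ℝ, y ⬝ᵥ y = 1 ∧ y ⬝ᵥ M *ᵥ y = hM.eigenvalues i := by
    intro i
    have h1 : (hM.eigenvectorBasis i).ofLp ⬝ᵥ (hM.eigenvectorBasis i).ofLp = 1 := by
      have := hM.eigenvectorBasis.orthonormal.1 i
      have h2 : inner ℝ (hM.eigenvectorBasis i) (hM.eigenvectorBasis i) = (1:ℝ) := by
        rw [real_inner_self_eq_norm_sq, this]; norm_num
      rw [EuclideanSpace.inner_eq_star_dotProduct] at h2
      simpa using h2
    refine ⟨(hM.eigenvectorBasis i).ofLp, h1, ?_⟩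
    rw [hM.mulVec_eigenvectorBasis, dotProduct_smul, h1]; simp
  have hl : ∀ i, a ≤ hM.eigenvalues i := by
    intro i
    obtain ⟨y, h1, h2⟩ := key i
    have := hlo y
    rw [h1, h2] at this; linarith
  have hu : ∀ i, hM.eigenvalues i ≤ b := by
    intro i
    obtain ⟨y, h1, h2⟩ := key i
    have := hup y
    rw [h1, h2] at this; linarith
  rw [hM.det_eq_prod_eigenvalues]
  simp only [RCLike.ofReal_real_eq_id, id]
  constructor
  · calc a ^ n = ∏ i : Fin n, a := by simp
      _ ≤ _ := Finset.prod_le_prod (fun i _ => ha) (fun i _ => hl i)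
  · calc _ ≤ ∏ i : Fin n, b := Finset.prod_le_prod (fun i _ => ha.trans (hl i)) (fun i _ => hu i)
      _ = b ^ n := by simp

open Matrix in
lemma herm_le_gershgorin {n : ℕ} (M : Matrix (Fin n) (Fin n) ℝ) :
    ∃ b : ℝ, ∀ y : Fin n → ℝ, y ⬝ᵥ M *ᵥ y ≤ b * (y ⬝ᵥ y) := by
  refine ⟨‖(Matrix.toEuclideanCLM (𝕜 := ℝ) M : Euc n →L[ℝ] Euc n)‖, fun y => ?_⟩
  have h1 := Matrix.inner_toEuclideanCLM M (WithLp.toLp 2 y) (WithLp.toLp 2 y)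
  have h2 : y ⬝ᵥ y = ‖(WithLp.toLp 2 y : Euc n)‖ ^ 2 := by
    rw [← real_inner_self_eq_norm_sq, EuclideanSpace.inner_eq_star_dotProduct]; simp
  have h3 := real_inner_le_norm (WithLp.toLp 2 y : Euc n)
    (Matrix.toEuclideanCLM (𝕜 := ℝ) M (WithLp.toLp 2 y))
  have h4 := (Matrix.toEuclideanCLM (𝕜 := ℝ) M : Euc n →L[ℝ] Euc n).le_opNorm (WithLp.toLp 2 y)
  rw [h2]
  have h5 := mul_le_mul_of_nonneg_left h4 (norm_nonneg (WithLp.toLp 2 y : Euc n))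
  change _ = y ⬝ᵥ M *ᵥ y at h1
  rw [← h1]
  nlinarith

open Matrix in
lemma conj_aux {n : ℕ} (H A : Matrix (Fin n) (Fin n) ℝ) (hH : H.IsHermitian) (hA : IsUnit A) :
    ((A⁻¹)ᵀ * H * A⁻¹).IsHermitian ∧ ((A⁻¹)ᵀ * H * A⁻¹).det * |A.det| ^ 2 = H.det ∧
    ∀ y : Fin n → ℝ, ∃ z, A *ᵥ z = y ∧ y ⬝ᵥ ((A⁻¹)ᵀ * H * A⁻¹) *ᵥ y = z ⬝ᵥ H *ᵥ z := by
  have hd : IsUnit A.det := (Matrix.isUnit_iff_isUnit_det A).1 hA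
  refine ⟨?_, ?_, ?_⟩
  · have := Matrix.isHermitian_conjTranspose_mul_mul (A⁻¹) hH
    simpa [Matrix.conjTranspose_eq_transpose_of_trivial] using this
  · have h0 : A.det ≠ 0 := hd.ne_zero
    rw [Matrix.det_mul, Matrix.det_mul, Matrix.det_transpose, Matrix.det_nonsing_inv, sq_abs]
    simp only [Ring.inverse_eq_inv']
    field_simp
  · intro y
    refine ⟨A⁻¹ *ᵥ y, ?_, ?_⟩
    · rw [Matrix.mulVec_mulVec, Matrix.mul_nonsing_inv _ hd, Matrix.one_mulVec]
    · rw [← Matrix.mulVec_mulVec, ← Matrix.mulVec_mulVec, Matrix.mulVec_transpose,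
        dotProduct_comm, ← Matrix.dotProduct_mulVec, dotProduct_comm]

open Matrix in
lemma det_le_aux {n : ℕ} (H A : Matrix (Fin n) (Fin n) ℝ) (hH : H.IsHermitian) (hA : IsUnit A)
    (b : ℝ) (hlo : ∀ y : Fin n → ℝ, 0 ≤ y ⬝ᵥ H *ᵥ y)
    (hup : ∀ y : Fin n → ℝ, y ⬝ᵥ H *ᵥ y ≤ b * ((A *ᵥ y) ⬝ᵥ (A *ᵥ y))) :
    H.det ≤ b ^ n * |A.det| ^ 2 := by
  obtain ⟨h1, h2, h3⟩ := conj_aux H A hH hA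
  rw [← h2]
  refine mul_le_mul_of_nonneg_right (herm_det_le _ h1 0 b le_rfl ?_ ?_).2 (sq_nonneg _)
  · intro y
    obtain ⟨z, rfl, hz⟩ := h3 y
    rw [hz]; simpa using hlo z
  · intro y
    obtain ⟨z, rfl, hz⟩ := h3 y
    rw [hz]; exact hup z

open Matrix in
lemma le_det_aux {n : ℕ} (H A : Matrix (Fin n) (Fin n) ℝ) (hH : H.IsHermitian) (hA : IsUnit A)
    (a : ℝ) (ha : 0 ≤ a)
    (hlo : ∀ y : Fin n → ℝ, a * ((A *ᵥ y) ⬝ᵥ (A *ᵥ y)) ≤ y ⬝ᵥ H *ᵥ y) :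
    a ^ n * |A.det| ^ 2 ≤ H.det := by
  obtain ⟨h1, h2, h3⟩ := conj_aux H A hH hA
  rw [← h2]
  obtain ⟨b, hb⟩ := herm_le_gershgorin ((A⁻¹)ᵀ * H * A⁻¹)
  refine mul_le_mul_of_nonneg_right (herm_det_le _ h1 a b ha ?_ hb).1 (sq_nonneg _)
  intro y
  obtain ⟨z, rfl, hz⟩ := h3 y
  rw [hz]; exact hlo z

open Topology in
lemma second_deriv_test (g : ℝ → ℝ) (hc : ContinuousAt g 0) (hm : IsLocalMax g 0) :
    deriv (deriv g) 0 ≤ 0 := by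
  by_contra hcon
  push Not at hcon
  have h1 := isLocalMin_of_deriv_deriv_pos hcon hm.deriv_eq_zero hc
  have h2 : g =ᶠ[𝓝 0] fun _ => g 0 := by
    filter_upwards [h1, hm] with s hs hs'
    exact le_antisymm hs' hs
  have h3 : deriv g =ᶠ[𝓝 0] deriv (fun _ => g 0) := h2.deriv
  have := h3.deriv_eq
  simp at this
  linarith

open Topology in
lemma hess_le {n : ℕ} (v : Euc n → ℝ) (p y : Euc n) (hv : ContDiffAt ℝ 2 v p) (b k : ℝ)
    (hloc : ∀ᶠ s : ℝ in 𝓝 0, v (p + s • y) ≤ v p + b * s + k * s ^ 2) :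
    fderiv ℝ (fderiv ℝ v) p y y ≤ 2 * k := by
  set g : ℝ → ℝ := fun s => v (p + s • y) - (v p + b * s + k * s ^ 2) with hg
  have hline : ∀ s : ℝ, HasDerivAt (fun s : ℝ => p + s • y) y s := by
    intro s
    simpa using ((hasDerivAt_id s).smul_const y).const_add p
  have hlt : Filter.Tendsto (fun s : ℝ => p + s • y) (𝓝 0) (𝓝 p) := by
    have := (hline 0).continuousAt.tendsto
    simpa using this
  have hdv : ∀ᶠ z in 𝓝 p, DifferentiableAt ℝ v z := by
    filter_upwards [hv.eventually (by simp)] with z hz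
    exact hz.differentiableAt (by norm_num)
  have hd1 : ∀ᶠ s in 𝓝 (0:ℝ), HasDerivAt g (fderiv ℝ v (p + s • y) y - (b + 2 * k * s)) s := by
    filter_upwards [hlt.eventually hdv] with s hs
    have h1 := hs.hasFDerivAt.comp_hasDerivAt s (hline s)
    have h2 : HasDerivAt (fun s : ℝ => v p + b * s + k * s ^ 2) (b + 2 * k * s) s := by
      have := (((hasDerivAt_id' s).const_mul b).const_add (v p)).add
        ((hasDerivAt_pow 2 s).const_mul k)
      exact this.congr_deriv (by norm_num; ring)
    exact h1.sub h2
  have hd2 : HasDerivAt (fun s : ℝ => fderiv ℝ v (p + s • y) y - (b + 2 * k * s))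
      (fderiv ℝ (fderiv ℝ v) p y y - 2 * k) 0 := by
    have hf : DifferentiableAt ℝ (fderiv ℝ v) p :=
      (hv.fderiv_right (m := 1) (by norm_num)).differentiableAt (by norm_num)
    have h1 : HasFDerivAt (fderiv ℝ v) (fderiv ℝ (fderiv ℝ v) p) (p + (0:ℝ) • y) := by
      simpa using hf.hasFDerivAt
    have h2a : HasDerivAt (fun s : ℝ => fderiv ℝ v (p + s • y)) (fderiv ℝ (fderiv ℝ v) p y) 0 :=
      h1.comp_hasDerivAt (0:ℝ) (hline 0)
    have h2 : HasDerivAt (fun s : ℝ => fderiv ℝ v (p + s • y) y)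
        (fderiv ℝ (fderiv ℝ v) p y y) 0 :=
      (ContinuousLinearMap.apply ℝ ℝ y).hasFDerivAt.comp_hasDerivAt (0:ℝ) h2a
    have h3 : HasDerivAt (fun s : ℝ => b + 2 * k * s) (2 * k) 0 := by
      simpa using ((hasDerivAt_id (0:ℝ)).const_mul (2 * k)).const_add b
    exact h2.sub h3
  have hgd : deriv g =ᶠ[𝓝 0] fun s : ℝ => fderiv ℝ v (p + s • y) y - (b + 2 * k * s) := by
    filter_upwards [hd1] with s hs using hs.deriv
  have h5 : deriv (deriv g) 0 = fderiv ℝ (fderiv ℝ v) p y y - 2 * k := by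
    rw [hgd.deriv_eq, hd2.deriv]
  have h6 := second_deriv_test g hd1.self_of_nhds.continuousAt (by
    filter_upwards [hloc] with s hs
    simp only [hg]; simp; linarith)
  linarith

open Topology in
lemma le_hess {n : ℕ} (v : Euc n → ℝ) (p y : Euc n) (hv : ContDiffAt ℝ 2 v p) (b k : ℝ)
    (hloc : ∀ᶠ s : ℝ in 𝓝 0, v p + b * s + k * s ^ 2 ≤ v (p + s • y)) :
    2 * k ≤ fderiv ℝ (fderiv ℝ v) p y y := by
  have := hess_le (fun z => - v z) p y hv.neg (-b) (-k) (by
    filter_upwards [hloc] with s hs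
    linarith)
  have h2 : fderiv ℝ (fun z => - v z) = fun z => - fderiv ℝ v z := by
    funext z; exact fderiv_fun_neg
  rw [h2, fderiv_fun_neg] at this
  simp at this
  linarith

open Matrix in
lemma hessianMatrix_quad {n : ℕ} (v : Euc n → ℝ) (p y : Euc n) :
    y.ofLp ⬝ᵥ hessianMatrix v p *ᵥ y.ofLp = fderiv ℝ (fderiv ℝ v) p y y := by
  have hy : y = ∑ i, y i • (EuclideanSpace.single i (1:ℝ) : Euc n) := by
    ext j
    simp [Finset.sum_apply, Pi.single_apply]
  conv_rhs => rw [hy]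
  simp only [map_sum, map_smul, _root_.sum_apply, _root_.smul_apply,
    dotProduct, mulVec, hessianMatrix, iteratedFDeriv_two_apply, Matrix.of_apply, smul_eq_mul,
    Finset.mul_sum]
  rw [Finset.sum_comm]
  simp
  refine Finset.sum_congr rfl fun i _ => Finset.sum_congr rfl fun j _ => ?_
  ring

lemma hessianMatrix_herm {n : ℕ} (v : Euc n → ℝ) (p : Euc n) (hv : ContDiffAt ℝ 2 v p) :
    (hessianMatrix v p).IsHermitian := by
  ext i j
  have := hv.isSymmSndFDerivAt (by simp)
  simp only [hessianMatrix, Matrix.conjTranspose_apply, Matrix.of_apply, iteratedFDeriv_two_apply]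
  simpa using this _ _

lemma tangent_le {n : ℕ} (Ω : Set (Euc n)) (v : Euc n → ℝ) (hvconv : ConvexOn ℝ Ω v)
    (p z : Euc n) (hp : p ∈ Ω) (hz : z ∈ Ω) (hd : DifferentiableAt ℝ v p) :
    v p + fderiv ℝ v p (z - p) ≤ v z := by
  have hline : HasDerivAt (fun s : ℝ => p + s • (z - p)) (z - p) 0 := by
    simpa using ((hasDerivAt_id (0:ℝ)).smul_const (z - p)).const_add p
  have hf : HasFDerivAt v (fderiv ℝ v p) (p + (0:ℝ) • (z - p)) := by simpa using hd.hasFDerivAt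
  have h1 := hf.comp_hasDerivAt (0:ℝ) hline
  have h2 : ConvexOn ℝ (Set.Icc (0:ℝ) 1) (v ∘ fun s : ℝ => p + s • (z - p)) := by
    have := hvconv.comp_affineMap (AffineMap.lineMap p z : ℝ →ᵃ[ℝ] Euc n)
    have h3 : (v ∘ fun s : ℝ => p + s • (z - p)) = v ∘ (AffineMap.lineMap p z : ℝ →ᵃ[ℝ] Euc n) := by
      funext s
      simp [AffineMap.lineMap_apply, add_comm]
    rw [h3]
    refine this.subset ?_ (convex_Icc _ _)
    intro s hs
    exact hvconv.1.segment_subset hp hz (by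
      rw [segment_eq_image_lineMap]; exact ⟨s, hs, rfl⟩)
  have h4 := h2.le_slope_of_hasDerivAt (x := 0) (y := 1) (by simp) (by simp) (by norm_num) h1
  simp [slope_def_field] at h4
  simpa using (by linarith : v p + (fderiv ℝ v p z - fderiv ℝ v p p) ≤ v z)

lemma quad_expand {n : ℕ} (L : Euc n →L[ℝ] Euc n) (t ξ p y : Euc n) (s : ℝ) :
    ‖L (p + s • y) + t - ξ‖ ^ 2 =
      ‖L p + t - ξ‖ ^ 2 + 2 * s * ⟪L p + t - ξ, L y⟫ + s ^ 2 * ‖L y‖ ^ 2 := by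
  have : L (p + s • y) + t - ξ = (L p + t - ξ) + s • L y := by
    rw [map_add, map_smul]; abel
  rw [this, norm_add_sq_real, inner_smul_right, norm_smul, mul_pow, Real.norm_eq_abs, sq_abs]
  ring

open Matrix in
lemma norm_L_sq {n : ℕ} (A : Matrix (Fin n) (Fin n) ℝ) (y : Fin n → ℝ) :
    ‖(Matrix.toEuclideanCLM (𝕜 := ℝ) A : Euc n →L[ℝ] Euc n) (WithLp.toLp 2 y)‖ ^ 2 =
      (A *ᵥ y) ⬝ᵥ (A *ᵥ y) := by
  rw [← real_inner_self_eq_norm_sq, EuclideanSpace.inner_eq_star_dotProduct]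
  simp

open Topology in
lemma line_tendsto {n : ℕ} (p y : Euc n) :
    Filter.Tendsto (fun s : ℝ => p + s • y) (𝓝 0) (𝓝 p) := by
  have : Continuous fun s : ℝ => p + s • y := by fun_prop
  simpa using this.tendsto 0

open Topology in
lemma touch_above {n : ℕ} (v : Euc n → ℝ) (p : Euc n) (hv : ContDiffAt ℝ 2 v p)
    (hpsd : ∀ y, 0 ≤ fderiv ℝ (fderiv ℝ v) p y y)
    (A : Matrix (Fin n) (Fin n) ℝ) (hA : IsUnit A) (t ξ : Euc n) (D : Euc n →L[ℝ] ℝ) (κ : ℝ)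
    (hloc : IsLocalMax (fun z => v z - D z
      - κ / 2 * ‖(Matrix.toEuclideanCLM (𝕜 := ℝ) A : Euc n →L[ℝ] Euc n) z + t - ξ‖ ^ 2) p) :
    hessDet v p ≤ κ ^ n * |A.det| ^ 2 := by
  refine det_le_aux _ A (hessianMatrix_herm v p hv) hA κ ?_ ?_
  · intro y
    have := hessianMatrix_quad v p (WithLp.toLp 2 y)
    simp only at this
    rw [this]; exact hpsd _
  · intro y
    have := hessianMatrix_quad v p (WithLp.toLp 2 y)
    simp only at this
    rw [this, ← norm_L_sq]
    set L : Euc n →L[ℝ] Euc n := Matrix.toEuclideanCLM (𝕜 := ℝ) A with hL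
    set Y : Euc n := WithLp.toLp 2 y
    have h1 := hess_le v p Y hv (D Y + κ * ⟪L p + t - ξ, L Y⟫) (κ / 2 * ‖L Y‖ ^ 2) (by
      filter_upwards [(line_tendsto p Y).eventually hloc] with s hs
      rw [quad_expand, map_add, map_smul, smul_eq_mul] at hs
      nlinarith)
    linarith

open Topology in
lemma touch_below {n : ℕ} (v : Euc n → ℝ) (p : Euc n) (hv : ContDiffAt ℝ 2 v p)
    (A : Matrix (Fin n) (Fin n) ℝ) (hA : IsUnit A) (t ξ : Euc n) (D : Euc n →L[ℝ] ℝ) (κ : ℝ)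
    (hκ : 0 ≤ κ)
    (hloc : IsLocalMin (fun z => v z - D z
      - κ / 2 * ‖(Matrix.toEuclideanCLM (𝕜 := ℝ) A : Euc n →L[ℝ] Euc n) z + t - ξ‖ ^ 2) p) :
    κ ^ n * |A.det| ^ 2 ≤ hessDet v p := by
  refine le_det_aux _ A (hessianMatrix_herm v p hv) hA κ hκ ?_
  intro y
  have := hessianMatrix_quad v p (WithLp.toLp 2 y)
  simp only at this
  rw [this, ← norm_L_sq]
  set L : Euc n →L[ℝ] Euc n := Matrix.toEuclideanCLM (𝕜 := ℝ) A with hL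
  set Y : Euc n := WithLp.toLp 2 y
  have h1 := le_hess v p Y hv (D Y + κ * ⟪L p + t - ξ, L Y⟫) (κ / 2 * ‖L Y‖ ^ 2) (by
    filter_upwards [(line_tendsto p Y).eventually hloc] with s hs
    rw [quad_expand, map_add, map_smul, smul_eq_mul] at hs
    nlinarith)
  linarith

open Topology in
lemma convex_psd {n : ℕ} (Ω : Set (Euc n)) (hΩ : IsOpen Ω) (v : Euc n → ℝ)
    (hvconv : ConvexOn ℝ Ω v) (p : Euc n) (hp : p ∈ Ω) (hv : ContDiffAt ℝ 2 v p) (y : Euc n) :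
    0 ≤ fderiv ℝ (fderiv ℝ v) p y y := by
  have := le_hess v p y hv (fderiv ℝ v p y) 0 (by
    filter_upwards [(line_tendsto p y).eventually (hΩ.mem_nhds hp)] with s hs
    have := tangent_le Ω v hvconv p _ hp hs (hv.differentiableAt (by norm_num))
    simp only [add_sub_cancel_left, map_smul, smul_eq_mul] at this
    linarith)
  linarith

lemma exists_between_scale {a b : ℝ} (ha : 0 ≤ a) (hab : a < b) :
    ∃ c : ℝ, 0 < c ∧ c < 1 ∧ a < c * b := by
  have hb : 0 < b := lt_of_le_of_lt ha hab
  obtain ⟨m, h1, h2⟩ := exists_between hab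
  refine ⟨m / b, div_pos (ha.trans_lt h1) hb, (div_lt_one hb).2 h2, ?_⟩
  rwa [div_mul_cancel₀ _ hb.ne']

/-- Size estimates for a section in terms of an affine transform `T z = A z + t`
quasi-normalising it: with `B_{r₁}(ξ₁) ⊆ T S(v,h,x) ⊆ B_{r₂}(ξ₂)` one controls
`(det T)^{2/n} h`, the diameter of the section, and `‖T⁻¹‖`.
(Here `det T` is the positive volume-scaling factor `|det A|` of the paper.) -/
theorem section_size_estimates (n : ℕ) (hn : 2 ≤ n)
    (Ω : Set (Euc n)) (hΩopen : IsOpen Ω) (hΩconv : Convex ℝ Ω)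
    (v f : Euc n → ℝ)
    (hv2 : ContDiffOn ℝ 2 v Ω) (hvc : ContinuousOn v (closure Ω)) (hvconv : ConvexOn ℝ Ω v)
    (hdet : ∀ z ∈ Ω, hessDet v z = f z ^ n)
    (h : ℝ) (hh : 0 < h) (x : Euc n) (hx : x ∈ Ω)
    (hsec : closure (secAt v h x Ω) ⊆ Ω)
    (fmax : ℝ) (hf : ∀ z ∈ secAt v h x Ω, 1 ≤ f z ∧ f z ≤ fmax)
    (A : Matrix (Fin n) (Fin n) ℝ) (t : Euc n) (hA : IsUnit A)
    (r₁ r₂ : ℝ) (ξ₁ ξ₂ : Euc n) (hr₁ : 0 < r₁) (hr₁₂ : r₁ ≤ r₂)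
    (hincl₁ : Metric.ball ξ₁ r₁ ⊆
      (fun z => Matrix.toEuclideanLin A z + t) '' secAt v h x Ω)
    (hincl₂ : (fun z => Matrix.toEuclideanLin A z + t) '' secAt v h x Ω ⊆
      Metric.ball ξ₂ r₂) :
    (r₁ ^ 2 / 2 ≤ |A.det| ^ ((2 : ℝ) / n) * h ∧
      |A.det| ^ ((2 : ℝ) / n) * h ≤ r₂ ^ 2 / 2 * fmax) ∧
    (r₁ / r₂ ≤
        Real.sqrt (8 * h) * matOpNorm ((|A.det| ^ (-(1 : ℝ) / n) • A)⁻¹) /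
          Metric.diam (secAt v h x Ω) ∧
      Real.sqrt (8 * h) * matOpNorm ((|A.det| ^ (-(1 : ℝ) / n) • A)⁻¹) /
          Metric.diam (secAt v h x Ω) ≤ r₂ / r₁ * Real.sqrt fmax) ∧
    matOpNorm (A⁻¹) ≤ Metric.diam (secAt v h x Ω) / (2 * r₁) := by
  have hn0 : n ≠ 0 := by omega
  have hnR : (n : ℝ) ≠ 0 := by exact_mod_cast hn0
  set S := secAt v h x Ω with hS
  set L : Euc n →L[ℝ] Euc n := Matrix.toEuclideanCLM (𝕜 := ℝ) A with hL
  set Li : Euc n →L[ℝ] Euc n := Matrix.toEuclideanCLM (𝕜 := ℝ) A⁻¹ with hLi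
  have hdu : IsUnit A.det := (Matrix.isUnit_iff_isUnit_det A).1 hA
  have hLLi : ∀ y, L (Li y) = y := by
    intro y
    have : (L * Li) y = y := by
      rw [hL, hLi, ← map_mul, Matrix.mul_nonsing_inv _ hdu, map_one]; rfl
    exact this
  have hLiL : ∀ y, Li (L y) = y := by
    intro y
    have : (Li * L) y = y := by
      rw [hL, hLi, ← map_mul, Matrix.nonsing_inv_mul _ hdu, map_one]; rfl
    exact this
  have hTL : (fun z => Matrix.toEuclideanLin A z + t) = fun z => L z + t := rfl
  rw [hTL] at hincl₁ hincl₂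
  have hr₂ : 0 < r₂ := hr₁.trans_le hr₁₂
  have hcd : ∀ z ∈ Ω, ContDiffAt ℝ 2 v z := fun z hz => hv2.contDiffAt (hΩopen.mem_nhds hz)
  have hdiff : ∀ z ∈ Ω, DifferentiableAt ℝ v z := fun z hz =>
    (hcd z hz).differentiableAt (by norm_num)
  have hcont : ContinuousOn v Ω := hv2.continuousOn
  set D : Euc n →L[ℝ] ℝ := fderiv ℝ v x with hD
  have hgrad : ∀ y, ⟪gradient v x, y⟫ = D y := by
    intro y
    rw [gradient, InnerProductSpace.toDual_symm_apply]
  have hSmem : ∀ z, z ∈ S ↔ z ∈ Ω ∧ v z < v x + (D z - D x) + h := by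
    intro z
    rw [hS, secAt, Set.mem_ofPred_eq, hgrad, map_sub]
  have hxS : x ∈ S := by rw [hSmem]; exact ⟨hx, by linarith⟩
  have hSopen : IsOpen S := by
    have : S = Ω ∩ (fun z => v z - D z) ⁻¹' Set.Iio (v x - D x + h) := by
      ext z
      rw [hSmem]
      simp only [Set.mem_inter_iff, Set.mem_preimage, Set.mem_Iio]
      constructor <;> rintro ⟨h1, h2⟩ <;> exact ⟨h1, by linarith⟩
    rw [this]
    exact (hcont.sub D.continuous.continuousOn).isOpen_inter_preimage hΩopen isOpen_Iio
  have htan : ∀ z ∈ Ω, v x + (D z - D x) ≤ v z := by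
    intro z hz
    have := tangent_le Ω v hvconv x z hx hz (hdiff x hx)
    rwa [map_sub] at this
  have hin2 : ∀ z ∈ S, ‖L z + t - ξ₂‖ < r₂ := by
    intro z hz
    have := hincl₂ ⟨z, hz, rfl⟩
    simpa [dist_eq_norm] using this
  have hin1 : ∀ z, ‖L z + t - ξ₁‖ < r₁ → z ∈ S := by
    intro z hz
    obtain ⟨z', hz', he⟩ := hincl₁ (show L z + t ∈ Metric.ball ξ₁ r₁ by
      simpa [dist_eq_norm] using hz)
    have h1 : L z' = L z := by simpa using he
    have h2 : z' = z := by rw [← hLiL z', h1, hLiL]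
    rwa [← h2]
  have hdist : ∀ z ∈ S, ∀ z' ∈ S, dist z z' ≤ ‖Li‖ * (2 * r₂) := by
    intro z hz z' hz'
    have h1 : z - z' = Li ((L z + t - ξ₂) - (L z' + t - ξ₂)) := by
      rw [← hLiL (z - z'), map_sub L]; congr 1; abel
    rw [dist_eq_norm, h1]
    refine (Li.le_opNorm _).trans (mul_le_mul_of_nonneg_left ?_ (norm_nonneg _))
    have := norm_sub_le (L z + t - ξ₂) (L z' + t - ξ₂)
    linarith [hin2 z hz, hin2 z' hz']
  have hbdd : Bornology.IsBounded S := Metric.isBounded_iff.2 ⟨_, fun z hz z' hz' => hdist z hz z' hz'⟩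
  have hdiam_le : Metric.diam S ≤ ‖Li‖ * (2 * r₂) :=
    Metric.diam_le_of_forall_dist_le (by positivity) hdist
  -- part (c)
  have hseg : ∀ u : Euc n, ‖u‖ < r₁ → 2 * ‖Li u‖ ≤ Metric.diam S := by
    intro u hu
    have h1 : Li (ξ₁ - t + u) ∈ S := hin1 _ (by
      have he : ξ₁ - t + u + t - ξ₁ = u := by abel
      rwa [hLLi, he])
    have h2 : Li (ξ₁ - t - u) ∈ S := hin1 _ (by
      have he : ξ₁ - t - u + t - ξ₁ = -u := by abel
      rwa [hLLi, he, norm_neg])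
    have h3 := Metric.dist_le_diam_of_mem hbdd h1 h2
    rw [dist_eq_norm, ← map_sub] at h3
    have h4 : ξ₁ - t + u - (ξ₁ - t - u) = (2:ℝ) • u := by rw [two_smul]; abel
    rw [h4, map_smul, norm_smul] at h3
    simpa using h3
  have hc : ‖Li‖ ≤ Metric.diam S / (2 * r₁) := by
    refine ContinuousLinearMap.opNorm_le_bound _
      (div_nonneg Metric.diam_nonneg (by positivity)) ?_
    intro u
    by_cases hu : u = 0
    · simp [hu]
    have hu0 : 0 < ‖u‖ := norm_pos_iff.2 hu
    rw [div_mul_eq_mul_div, le_div_iff₀ (by positivity)]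
    by_contra hcon
    push Not at hcon
    obtain ⟨a, ha0, ha, hlt⟩ := exists_between_scale
      (mul_nonneg Metric.diam_nonneg hu0.le) hcon
    have h1 := hseg ((a * r₁ / ‖u‖) • u) (by
      rw [norm_smul, Real.norm_eq_abs, abs_of_pos (by positivity), div_mul_cancel₀ _ hu0.ne']
      nlinarith)
    rw [map_smul, norm_smul, Real.norm_eq_abs, abs_of_pos (by positivity)] at h1
    have h2 := mul_le_mul_of_nonneg_right h1 hu0.le
    have h3 : 2 * (a * r₁ / ‖u‖ * ‖Li u‖) * ‖u‖ = a * (‖Li u‖ * (2 * r₁)) := by field_simp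
    linarith
  set d := |A.det| with hd
  have hd0 : 0 < d := abs_pos.2 hdu.ne_zero
  set δ := d ^ ((2 : ℝ) / n) with hδ
  have hδ0 : 0 < δ := Real.rpow_pos_of_pos hd0 _
  have hδn : δ ^ n = d ^ 2 := by
    rw [hδ, ← Real.rpow_natCast, ← Real.rpow_mul hd0.le, div_mul_cancel₀ _ hnR]
    norm_num
  have hfm : 1 ≤ fmax := (hf x hxS).1.trans (hf x hxS).2
  have ha1 : r₁ ^ 2 / 2 ≤ δ * h := by
    by_contra hcon
    push Not at hcon
    obtain ⟨c, hc0, hc1, hcc⟩ := exists_between_scale (by positivity) hcon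
    set κ := c / δ with hκ
    have hκ0 : 0 < κ := by positivity
    have hrad : ∃ ρ, 0 < ρ ∧ ρ < r₁ ∧ h < κ / 2 * ρ ^ 2 := by
      have h1 : h < κ / 2 * r₁ ^ 2 := by
        have : κ / 2 * r₁ ^ 2 = c * (r₁ ^ 2 / 2) / δ := by rw [hκ]; field_simp
        rw [this, lt_div_iff₀ hδ0]; linarith
      have h2 : Real.sqrt (2 * h / κ) < r₁ := by
        rw [Real.sqrt_lt' hr₁, div_lt_iff₀ hκ0]; linarith
      obtain ⟨ρ, h3, h4⟩ := exists_between h2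
      have h5 : 0 < ρ := (Real.sqrt_nonneg _).trans_lt h3
      refine ⟨ρ, h5, h4, ?_⟩
      rw [Real.sqrt_lt' h5, div_lt_iff₀ hκ0] at h3
      linarith
    obtain ⟨ρ, hρ0, hρ1, hρ2⟩ := hrad
    set K : Set (Euc n) := {z | ‖L z + t - ξ₁‖ ≤ ρ} with hK
    have hKS : K ⊆ S := fun z hz => hin1 z (lt_of_le_of_lt hz hρ1)
    have hSΩ : S ⊆ Ω := fun z hz => ((hSmem z).1 hz).1
    have hKcl : IsClosed K := isClosed_le (by fun_prop) continuous_const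
    have hKcomp : IsCompact K := Metric.isCompact_of_isClosed_isBounded hKcl (hbdd.subset hKS)
    have hz0 : L (Li (ξ₁ - t)) + t - ξ₁ = 0 := by rw [hLLi]; abel
    have hz1 : Li (ξ₁ - t) ∈ K := by
      rw [hK, Set.mem_ofPred_eq, hz0, norm_zero]; exact hρ0.le
    obtain ⟨p, hpK, hpmax⟩ := hKcomp.exists_isMaxOn ⟨_, hz1⟩
      (f := fun z => v z - D z - κ / 2 * ‖L z + t - ξ₁‖ ^ 2)
      (by
        have h1 : ContinuousOn v K := hcont.mono (hKS.trans hSΩ)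
        have h2 : Continuous fun z => κ / 2 * ‖L z + t - ξ₁‖ ^ 2 := by fun_prop
        exact (h1.sub D.continuous.continuousOn).sub h2.continuousOn)
    have hpS := hKS hpK
    have hpΩ := hSΩ hpS
    have hplt : ‖L p + t - ξ₁‖ < ρ := by
      refine lt_of_le_of_ne hpK fun heq => ?_
      have h1 := hpmax hz1
      simp only [Set.mem_ofPred_eq] at h1
      rw [heq, hz0, norm_zero] at h1
      have h2 := htan _ (hSΩ (hKS hz1))
      have h3 := ((hSmem p).1 hpS).2
      linarith
    have hnhds : K ∈ nhds p := by
      have ho : IsOpen {z : Euc n | ‖L z + t - ξ₁‖ < ρ} := isOpen_lt (by fun_prop) continuous_const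
      exact Filter.mem_of_superset (ho.mem_nhds hplt) fun z hz => by
        have hz' : ‖L z + t - ξ₁‖ < ρ := hz
        exact hz'.le
    have h5 := touch_above v p (hcd p hpΩ) (convex_psd Ω hΩopen v hvconv p hpΩ (hcd p hpΩ))
      A hA t ξ₁ D κ (hpmax.isLocalMax hnhds)
    have hκδ : κ * δ = c := by rw [hκ]; field_simp
    rw [hdet p hpΩ, ← hd, ← hδn, ← mul_pow, hκδ] at h5
    have h7 : 1 ≤ f p ^ n := one_le_pow₀ (hf p hpS).1
    have h8 : c ^ n < 1 := pow_lt_one₀ hc0.le hc1 hn0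
    linarith
  have ha2 : δ * h ≤ r₂ ^ 2 / 2 * fmax := by
    by_contra hcon
    push Not at hcon
    obtain ⟨m, hm1, hm2⟩ := exists_between hcon
    set κ := 2 * m / (r₂ ^ 2 * δ) with hκ
    have hm0 : 0 < m := lt_of_le_of_lt (by positivity) hm1
    have hκ0 : 0 < κ := by positivity
    have hκh : κ / 2 * r₂ ^ 2 < h := by
      have : κ / 2 * r₂ ^ 2 = m / δ := by rw [hκ]; field_simp
      rw [this, div_lt_iff₀ hδ0]; linarith
    have hκf : fmax < κ * δ := by
      have : κ * δ = 2 * m / r₂ ^ 2 := by rw [hκ]; field_simp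
      rw [this, lt_div_iff₀ (by positivity)]; linarith
    have hcomp : IsCompact (closure S) := hbdd.isCompact_closure
    obtain ⟨p, hpc, hpmin⟩ := hcomp.exists_isMinOn ⟨x, subset_closure hxS⟩
      (f := fun z => v z - D z - κ / 2 * ‖L z + t - ξ₂‖ ^ 2)
      (by
        have h1 : ContinuousOn v (closure S) := hcont.mono hsec
        have h2 : Continuous fun z => κ / 2 * ‖L z + t - ξ₂‖ ^ 2 := by fun_prop
        exact (h1.sub D.continuous.continuousOn).sub h2.continuousOn)
    have hple : ‖L p + t - ξ₂‖ ≤ r₂ := by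
      have hcl : IsClosed {z : Euc n | ‖L z + t - ξ₂‖ ≤ r₂} :=
        isClosed_le (by fun_prop) continuous_const
      exact closure_minimal (fun z hz => (hin2 z hz).le) hcl hpc
    have hpS : p ∈ S := by
      by_contra hpn
      rw [hSmem] at hpn
      push Not at hpn
      have h1 := hpn (hsec hpc)
      have h2 := hpmin (subset_closure hxS)
      simp only [Set.mem_ofPred_eq] at h2
      have h3 : κ / 2 * ‖L p + t - ξ₂‖ ^ 2 ≤ κ / 2 * r₂ ^ 2 := by gcongr
      have h4 : 0 ≤ κ / 2 * ‖L x + t - ξ₂‖ ^ 2 := by positivity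
      linarith
    have hpΩ : p ∈ Ω := hsec hpc
    have h5 := touch_below v p (hcd p hpΩ) A hA t ξ₂ D κ hκ0.le
      (hpmin.isLocalMin (Filter.mem_of_superset (hSopen.mem_nhds hpS) subset_closure))
    rw [hdet p hpΩ, ← hd, ← hδn, ← mul_pow] at h5
    have h6 := hf p hpS
    have h7 : f p ^ n ≤ fmax ^ n := pow_le_pow_left₀ (by linarith) h6.2 n
    have h8 : fmax ^ n < (κ * δ) ^ n := pow_lt_pow_left₀ hκf (by linarith) hn0
    linarith
  have hLi0 : 0 < ‖Li‖ := by
    rw [norm_pos_iff]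
    intro h0
    have h1 := hLiL (EuclideanSpace.single ⟨0, by omega⟩ (1:ℝ))
    rw [h0] at h1
    have h2 := congrArg norm h1
    simp at h2
  have hdiam0 : 0 < Metric.diam S := by
    have := hLi0.trans_le hc
    by_contra hcon
    have h0 : Metric.diam S = 0 := le_antisymm (not_lt.1 hcon) Metric.diam_nonneg
    rw [h0] at this; simp at this
  have hop : matOpNorm ((d ^ (-(1 : ℝ) / n) • A)⁻¹) = d ^ ((1 : ℝ) / n) * ‖Li‖ := by
    have hne : d ^ (-(1 : ℝ) / n) ≠ 0 := (Real.rpow_pos_of_pos hd0 _).ne'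
    have h1 : (d ^ (-(1 : ℝ) / n) • A)⁻¹ = d ^ ((1 : ℝ) / n) • A⁻¹ := by
      refine Matrix.inv_eq_left_inv ?_
      rw [Matrix.smul_mul, Matrix.mul_smul, Matrix.nonsing_inv_mul _ hdu, smul_smul,
        ← Real.rpow_add hd0]
      have : (1:ℝ) / n + -1 / n = 0 := by ring
      rw [this, Real.rpow_zero, one_smul]
    rw [h1, matOpNorm, map_smul, norm_smul, Real.norm_eq_abs,
      abs_of_pos (Real.rpow_pos_of_pos hd0 _)]
  have hsq : Real.sqrt (8 * h) * d ^ ((1 : ℝ) / n) = Real.sqrt (8 * (δ * h)) := by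
    have h1 : δ = (d ^ ((1 : ℝ) / n)) ^ 2 := by
      rw [hδ, ← Real.rpow_natCast, ← Real.rpow_mul hd0.le]
      congr 1
      push_cast; ring
    have h2 : 8 * (δ * h) = 8 * h * (d ^ ((1 : ℝ) / n)) ^ 2 := by rw [h1]; ring
    rw [h2, Real.sqrt_mul (x := 8 * h) (by positivity), Real.sqrt_sq (Real.rpow_pos_of_pos hd0 _).le]
  have hs1 : 2 * r₁ ≤ Real.sqrt (8 * (δ * h)) := by
    apply Real.le_sqrt_of_sq_le; nlinarith
  have hs2 : Real.sqrt (8 * (δ * h)) ≤ 2 * r₂ * Real.sqrt fmax := by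
    rw [Real.sqrt_le_left (by positivity), mul_pow, Real.sq_sqrt (by linarith)]; nlinarith
  refine ⟨⟨ha1, ha2⟩, ⟨?_, ?_⟩, hc⟩
  · rw [hop, ← mul_assoc, hsq, div_le_div_iff₀ hr₂ hdiam0]
    calc r₁ * Metric.diam S ≤ r₁ * (‖Li‖ * (2 * r₂)) := by gcongr
      _ = 2 * r₁ * ‖Li‖ * r₂ := by ring
      _ ≤ _ := by gcongr
  · rw [hop, ← mul_assoc, hsq, div_le_iff₀ hdiam0]
    calc _ ≤ 2 * r₂ * Real.sqrt fmax * (Metric.diam S / (2 * r₁)) := by gcongr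
      _ = _ := by field_simp
end
end
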